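/- arXiv:1110.2544 — 11 statements merged into one kernel-verified Lean document; each statement's English description precedes it below -/
import Mathlib

section
/- Let A (with rows A_0,…,A_m) and B (with rows B_0,…,B_n) be two model matrices on the same finite sample space X, both with first row identically 1, and let μ be a common strictly positive reference measure. The interiors of the A-model and the B-model coincide as sets of densities, i.e. {p_A(·;t) : t ∈ ℝ_{>0}^{m+1}} = {p_B(·;s) : s ∈ ℝ_{>0}^{n+1}}, if, and only if, the real row span of A equals the real row span of B (as subspaces of ℝ^X). -/
lemma aux_prod {X : Type*} {m : ℕ} (A : Fin (m + 1) → X → ℕ) (c : Fin (m + 1) → ℝ) (x : X) :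
    ∏ i, (Real.exp (c i)) ^ A i x = Real.exp ((∑ i, c i • (fun x => (A i x : ℝ))) x) := by
  rw [Finset.sum_apply, Real.exp_sum]
  refine Finset.prod_congr rfl fun i _ => ?_
  rw [← Real.exp_nat_mul]
  simp [mul_comm]

lemma aux_model {X : Type*} [Fintype X] (μ : X → ℝ) {m : ℕ} (A : Fin (m + 1) → X → ℕ) :
    {p : X → ℝ | ∃ t : Fin (m + 1) → ℝ, (∀ i, 0 < t i) ∧
        p = fun x => (∏ i, t i ^ A i x) / ∑ y, (∏ i, t i ^ A i y) * μ y}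
    = (fun f : X → ℝ => fun x => Real.exp (f x) / ∑ y, Real.exp (f y) * μ y) ''
      (Submodule.span ℝ (Set.range fun i => fun x => (A i x : ℝ)) : Set (X → ℝ)) := by
  ext p
  constructor
  · rintro ⟨t, ht, rfl⟩
    obtain ⟨c, rfl⟩ : ∃ c : Fin (m + 1) → ℝ, t = fun i => Real.exp (c i) :=
      ⟨fun i => Real.log (t i), funext fun i => (Real.exp_log (ht i)).symm⟩
    refine ⟨∑ i, c i • (fun x => (A i x : ℝ)),
      (Submodule.mem_span_range_iff_exists_fun ℝ).2 ⟨c, rfl⟩, ?_⟩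
    simp only [aux_prod]
  · rintro ⟨f, hf, rfl⟩
    obtain ⟨c, rfl⟩ := (Submodule.mem_span_range_iff_exists_fun ℝ).1 hf
    refine ⟨fun i => Real.exp (c i), fun i => Real.exp_pos _, ?_⟩
    simp only [aux_prod]

lemma aux_le {X : Type*} [Fintype X] [Nonempty X] (μ : X → ℝ) (hμ : ∀ x, 0 < μ x)
    (S T : Submodule ℝ (X → ℝ)) (hT : (fun _ => (1 : ℝ)) ∈ T)
    (h : (fun f : X → ℝ => fun x => Real.exp (f x) / ∑ y, Real.exp (f y) * μ y) '' (S : Set (X → ℝ))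
      ⊆ (fun f : X → ℝ => fun x => Real.exp (f x) / ∑ y, Real.exp (f y) * μ y) ''
        (T : Set (X → ℝ))) : S ≤ T := by
  have hZ : ∀ f : X → ℝ, 0 < ∑ y, Real.exp (f y) * μ y := fun f =>
    Finset.sum_pos (fun y _ => mul_pos (Real.exp_pos _) (hμ y)) Finset.univ_nonempty
  intro f hf
  obtain ⟨g, hg, hgf⟩ := h ⟨f, hf, rfl⟩
  have key : f = g + (Real.log (∑ y, Real.exp (f y) * μ y)
      - Real.log (∑ y, Real.exp (g y) * μ y)) • (fun _ => (1 : ℝ)) := by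
    funext x
    have h1 := congrArg Real.log (congrFun hgf x)
    simp only at h1
    rw [Real.log_div (Real.exp_pos _).ne' (hZ g).ne', Real.log_div (Real.exp_pos _).ne' (hZ f).ne',
      Real.log_exp, Real.log_exp] at h1
    simp only [Pi.add_apply, Pi.smul_apply, smul_eq_mul]
    linarith
  rw [key]
  exact T.add_mem hg (T.smul_mem _ hT)

/-- The interiors of the `A`-model and the `B`-model (with respect to a common
strictly positive reference measure `μ`) coincide as sets of densities iff the real row
spans of `A` and `B` coincide. -/
theorem stmt1 {X : Type*} [Fintype X] [Nonempty X]
    (μ : X → ℝ) (hμ : ∀ x, 0 < μ x)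
    (m n : ℕ) (A : Fin (m + 1) → X → ℕ) (B : Fin (n + 1) → X → ℕ)
    (hA0 : ∀ x, A 0 x = 1) (hB0 : ∀ x, B 0 x = 1) :
    ({p : X → ℝ | ∃ t : Fin (m + 1) → ℝ, (∀ i, 0 < t i) ∧
        p = fun x => (∏ i, t i ^ A i x) / ∑ y, (∏ i, t i ^ A i y) * μ y}
      = {p : X → ℝ | ∃ s : Fin (n + 1) → ℝ, (∀ j, 0 < s j) ∧
        p = fun x => (∏ j, s j ^ B j x) / ∑ y, (∏ j, s j ^ B j y) * μ y})
      ↔ Submodule.span ℝ (Set.range fun i => fun x => (A i x : ℝ))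
          = Submodule.span ℝ (Set.range fun j => fun x => (B j x : ℝ)) := by
  have h1 : ∀ (k : ℕ) (C : Fin (k + 1) → X → ℕ), (∀ x, C 0 x = 1) →
      (fun _ => (1 : ℝ)) ∈ Submodule.span ℝ (Set.range fun i => fun x => (C i x : ℝ)) := by
    intro k C hC
    refine Submodule.subset_span ⟨0, ?_⟩
    funext x
    simp [hC]
  rw [aux_model, aux_model]
  constructor
  · intro h
    exact le_antisymm (aux_le μ hμ _ _ (h1 n B hB0) h.subset)
      (aux_le μ hμ _ _ (h1 m A hA0) h.symm.subset)
  · intro h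
    rw [h]
end

section
/- Let A be a model matrix on a finite sample space X with first row identically 1 and let μ be a strictly positive reference measure. The set of all nonnegative functions p: X → ℝ_{≥0} with Σ_{x∈X} p(x) μ(x) = 1 satisfying the binomial equations ∏_{x : k(x)>0} p(x)^{k(x)} = ∏_{x : k(x)<0} p(x)^{−k(x)} for every integer vector k ∈ ℤ^X with Σ_{x∈X} k(x) A_i(x) = 0 for all i = 0,…,m, equals the closure in ℝ^X of the interior of the A-model {p(·;t) : t ∈ ℝ_{>0}^{m+1}}. -/
lemma aux_binom {X : Type*} [Fintype X] (p : X → ℝ) (k : X → ℤ) (h : ∀ x, k x ≠ 0 → 0 < p x) :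
    ((∏ x ∈ Finset.univ.filter (fun x => 0 < k x), p x ^ (k x).toNat)
            = ∏ x ∈ Finset.univ.filter (fun x => k x < 0), p x ^ (-k x).toNat) ↔
      ∑ x, (k x : ℝ) * Real.log (p x) = 0 := by
  have e1 : 0 < ∏ x ∈ Finset.univ.filter (fun x => 0 < k x), p x ^ (k x).toNat := by
    refine Finset.prod_pos fun x hx => pow_pos (h x ?_) _
    have := (Finset.mem_filter.1 hx).2
    omega
  have e2 : 0 < ∏ x ∈ Finset.univ.filter (fun x => k x < 0), p x ^ (-k x).toNat := by
    refine Finset.prod_pos fun x hx => pow_pos (h x ?_) _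
    have := (Finset.mem_filter.1 hx).2
    omega
  rw [← Real.log_injOn_pos.eq_iff (Set.mem_Ioi.2 e1) (Set.mem_Ioi.2 e2), Real.log_prod, Real.log_prod,
    ← sub_eq_zero, Finset.sum_filter, Finset.sum_filter, ← Finset.sum_sub_distrib]
  · have : ∀ x, ((if 0 < k x then Real.log (p x ^ (k x).toNat) else 0) -
        if k x < 0 then Real.log (p x ^ (-k x).toNat) else 0) = (k x : ℝ) * Real.log (p x) := by
      intro x
      rcases lt_trichotomy (k x) 0 with h1 | h1 | h1
      · have h2 : ((-k x).toNat : ℤ) = - k x := Int.toNat_of_nonneg (by omega)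
        have h3 : ((-k x).toNat : ℝ) = - k x := by exact_mod_cast h2
        rw [if_neg (by omega), if_pos h1, Real.log_pow, h3]; ring
      · simp [h1]
      · have h2 : ((k x).toNat : ℤ) = k x := Int.toNat_of_nonneg (by omega)
        have h3 : ((k x).toNat : ℝ) = k x := by exact_mod_cast h2
        rw [if_pos h1, if_neg (by omega), Real.log_pow, h3]; ring
    simp only [this]
  · intro x hx
    have := (Finset.mem_filter.1 hx).2
    exact (pow_pos (h x (by omega)) _).ne'
  · intro x hx
    have := (Finset.mem_filter.1 hx).2
    exact (pow_pos (h x (by omega)) _).ne'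

lemma aux_approxQ {X : Type*} [Fintype X] (v : X → ℝ) (U : Set (X → ℝ)) (hU : IsOpen U)
    (hv : v ∈ U) : ∃ φ : X → ℚ, (fun x => (φ x : ℝ)) ∈ U ∧
      ∀ c : X → ℚ, ∑ x, (c x : ℝ) * v x = 0 → ∑ x, c x * φ x = 0 := by
  classical
  let M := Submodule.span ℚ (Set.range v)
  haveI : Module.Finite ℚ M := Module.Finite.span_of_finite ℚ (Set.finite_range v)
  let b := Module.finBasis ℚ M
  let w : X → M := fun x => ⟨v x, Submodule.subset_span ⟨x, rfl⟩⟩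
  let F : (Fin (Module.finrank ℚ M) → ℝ) → (X → ℝ) := fun r x => ∑ j, (b.repr (w x) j : ℝ) * r j
  have hF : Continuous F := by
    refine continuous_pi fun x => ?_
    fun_prop
  have hFb : F (fun j => (b j : ℝ)) = v := by
    funext x
    have := congrArg (fun z : M => (z : ℝ)) (b.sum_repr (w x))
    simp only [Submodule.coe_sum, Submodule.coe_smul, Rat.smul_def] at this
    exact this
  have hd : DenseRange (Pi.map (fun (_ : Fin (Module.finrank ℚ M)) (q : ℚ) => (q : ℝ))) :=
    DenseRange.piMap fun _ => Rat.denseRange_cast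
  obtain ⟨r, hr⟩ := hd.exists_mem_open (hU.preimage hF) ⟨_, by
    show F (fun j => (b j : ℝ)) ∈ U
    rw [hFb]; exact hv⟩
  refine ⟨fun x => ∑ j, b.repr (w x) j * r j, ?_, ?_⟩
  · have e : (fun x => ((∑ j, b.repr (w x) j * r j : ℚ) : ℝ)) =
        F (Pi.map (fun _ (q : ℚ) => (q : ℝ)) r) := by
      funext x
      simp [F, Pi.map]
    rw [e]
    exact hr
  · intro c hc
    have h0 : ∑ x, c x • w x = 0 := by
      apply Subtype.ext
      simp only [Submodule.coe_sum, Submodule.coe_smul, Rat.smul_def]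
      exact hc
    have h1 : ∀ j, ∑ x, c x * b.repr (w x) j = 0 := by
      intro j
      have := congrArg (fun z => b.repr z j) h0
      simpa [map_sum, Finsupp.finsetSum_apply] using this
    simp only [Finset.mul_sum]
    rw [Finset.sum_comm]
    refine Finset.sum_eq_zero fun j _ => ?_
    simp only [← mul_assoc]
    rw [← Finset.sum_mul, h1, zero_mul]

lemma aux_approx {X : Type*} [Fintype X] (v : X → ℝ) (U : Set (X → ℝ)) (hU : IsOpen U)
    (hv : v ∈ U) : ∃ k : X → ℤ, ∃ N : ℕ, 0 < N ∧ (fun x => (k x : ℝ) / N) ∈ U ∧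
      (∀ c : X → ℤ, ∑ x, (c x : ℝ) * v x = 0 → ∑ x, k x * c x = 0) ∧
      ∀ x, v x = 0 → k x = 0 := by
  classical
  obtain ⟨φ, h1, h2⟩ := aux_approxQ v U hU hv
  obtain ⟨⟨N, hN⟩, hk⟩ := IsLocalization.exist_integer_multiples (nonZeroDivisors ℤ) Finset.univ φ
  have hN0 : N ≠ 0 := nonZeroDivisors.ne_zero hN
  choose k hk using fun x => hk x (Finset.mem_univ x)
  have hk' : ∀ x, (k x : ℚ) = N * φ x := by
    intro x
    have := hk x
    simpa [Submonoid.smul_def] using this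
  have hkey : ∀ c : X → ℤ, ∑ x, (c x : ℝ) * v x = 0 → ∑ x, (N.sign * k x) * c x = 0 := by
    intro c hc
    have := h2 (fun x => c x) (by simpa using hc)
    have h3 : ((∑ x, (N.sign * k x) * c x : ℤ) : ℚ) = 0 := by
      push_cast
      simp only [hk']
      calc _ = (N.sign : ℚ) * N * ∑ x, c x * φ x := by
            rw [Finset.mul_sum]; exact Finset.sum_congr rfl fun x _ => by ring
        _ = 0 := by rw [this, mul_zero]
    exact_mod_cast h3
  refine ⟨fun x => N.sign * k x, N.natAbs, Int.natAbs_pos.2 hN0, ?_, hkey, ?_⟩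
  · convert h1 using 1
    funext x
    have a1 : (k x : ℝ) = N * φ x := by exact_mod_cast hk' x
    have a2 : (N.sign : ℝ) * N = N.natAbs := by
      have := congrArg (fun z : ℤ => (z : ℝ)) (Int.sign_mul_self N)
      simp only [Int.cast_mul, Int.cast_natCast] at this
      exact this
    have a3 : (N.natAbs : ℝ) ≠ 0 := by
      simpa using hN0
    rw [div_eq_iff a3]
    push_cast
    rw [a1, ← a2]; ring
  · intro x hx
    have := hkey (Pi.single x 1) (by
      rw [Finset.sum_eq_single x] <;> simp +contextual [hx])
    rw [Finset.sum_eq_single x] at this <;> simp_all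

lemma aux_log {X : Type*} [Fintype X] (m : ℕ) (A : Fin (m + 1) → X → ℕ) (p : X → ℝ)
    (hp : ∀ x, 0 ≤ p x)
    (hb : ∀ k : X → ℤ, (∀ i, ∑ x, k x * (A i x : ℤ) = 0) →
          (∏ x ∈ Finset.univ.filter (fun x => 0 < k x), p x ^ (k x).toNat)
            = ∏ x ∈ Finset.univ.filter (fun x => k x < 0), p x ^ (-k x).toNat) :
    ∃ θ : Fin (m + 1) → ℝ, ∀ x, p x ≠ 0 → Real.log (p x) = ∑ i, θ i * A i x := by
  classical
  let T : (Fin (m + 1) → ℝ) →ₗ[ℝ] (X → ℝ) := (Matrix.of fun x i => (A i x : ℝ)).mulVecLin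
  let Z : Submodule ℝ (X → ℝ) :=
    { carrier := {f | ∀ x, p x ≠ 0 → f x = 0}
      add_mem' := fun {a b} ha hb x hx => by simp [ha x hx, hb x hx]
      zero_mem' := fun x _ => rfl
      smul_mem' := fun c a ha x hx => by simp [ha x hx] }
  by_cases hg : (fun x => Real.log (p x)) ∈ LinearMap.range T ⊔ Z
  · obtain ⟨_, ⟨θ, rfl⟩, z, hz, h⟩ := Submodule.mem_sup.1 hg
    refine ⟨θ, fun x hx => ?_⟩
    have := congrFun h x
    simp only [Pi.add_apply, hz x hx, add_zero] at this
    rw [← this]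
    simp [T, Matrix.mulVec, dotProduct, mul_comm]
  · exfalso
    obtain ⟨f, hf, hle⟩ := Submodule.exists_le_ker_of_notMem hg
    let v : X → ℝ := fun x => f (Pi.single x 1)
    have hfv : ∀ g : X → ℝ, f g = ∑ x, g x * v x := by
      intro g
      rw [LinearMap.pi_apply_eq_sum_univ f g]
      simp only [smul_eq_mul, v]
      refine Finset.sum_congr rfl fun x _ => ?_
      congr 2
      funext y
      simp [Pi.single_apply, eq_comm]
    have hv0 : ∀ x, p x = 0 → v x = 0 := by
      intro x hx
      refine hle (Submodule.mem_sup_right (fun y hy => ?_))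
      have : y ≠ x := by rintro rfl; exact hy hx
      simp [this]
    have hvA : ∀ i, ∑ x, (A i x : ℝ) * v x = 0 := by
      intro i
      have : f (T (Pi.single i 1)) = 0 := hle (Submodule.mem_sup_left ⟨_, rfl⟩)
      rw [hfv] at this
      simpa [T] using this
    obtain ⟨k, N, hN, hkU, hkc, hk0⟩ := aux_approx v {u | ∑ x, Real.log (p x) * u x ≠ 0}
      (isOpen_ne_fun (by fun_prop) continuous_const) (by
        show _ ≠ _
        rw [hfv] at hf; exact hf)
    have hbk := hb k (fun i => hkc (fun x => A i x) (by simpa using hvA i))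
    rw [aux_binom p k (fun x hx => lt_of_le_of_ne (hp x) fun h => hx (hk0 x (hv0 x h.symm)))] at hbk
    apply hkU
    calc _ = (∑ x, (k x : ℝ) * Real.log (p x)) / N := by
          rw [Finset.sum_div]; exact Finset.sum_congr rfl fun x _ => by ring
      _ = 0 := by rw [hbk, zero_div]

lemma aux_face {X : Type*} [Fintype X] (m : ℕ) (A : Fin (m + 1) → X → ℕ) (p : X → ℝ)
    (hb : ∀ k : X → ℤ, (∀ i, ∑ x, k x * (A i x : ℤ) = 0) →
          (∏ x ∈ Finset.univ.filter (fun x => 0 < k x), p x ^ (k x).toNat)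
            = ∏ x ∈ Finset.univ.filter (fun x => k x < 0), p x ^ (-k x).toNat) :
    ∃ w : Fin (m + 1) → ℝ, (∀ x, p x ≠ 0 → ∑ i, w i * A i x = 0) ∧
      ∀ x, p x = 0 → ∑ i, w i * A i x < 0 := by
  classical
  let a : X → (Fin (m + 1) → ℝ) := fun x i => A i x
  let P : Finset X := Finset.univ.filter fun x => p x = 0
  let C : Set (Fin (m + 1) → ℝ) := convexHull ℝ (a '' {x | p x = 0})
  let L : Submodule ℝ (Fin (m + 1) → ℝ) := Submodule.span ℝ (a '' {x | p x ≠ 0})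
  by_cases hd : Disjoint C (L : Set (Fin (m + 1) → ℝ))
  · obtain ⟨f, u, v, h1, huv, h2⟩ := geometric_hahn_banach_compact_closed
      (convex_convexHull ℝ _) ((Set.toFinite _).isCompact_convexHull (𝕜 := ℝ)) L.convex
      (L.closed_of_finiteDimensional) hd
    have hv : v < 0 := by simpa using h2 0 L.zero_mem
    have hL : ∀ l ∈ L, f l = 0 := by
      intro l hl
      by_contra hne
      have := h2 ((v / f l) • l) (L.smul_mem _ hl)
      simp [hne] at this
    have hf : ∀ x, f (a x) = ∑ i, f (Pi.single i 1) * A i x := by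
      intro x
      have := LinearMap.pi_apply_eq_sum_univ (f : (Fin (m + 1) → ℝ) →ₗ[ℝ] ℝ) (a x)
      simp only [ContinuousLinearMap.coe_coe] at this
      rw [this]
      refine Finset.sum_congr rfl fun i _ => ?_
      rw [smul_eq_mul, mul_comm]
      congr 2
      funext y
      simp [Pi.single_apply, eq_comm]
    refine ⟨fun i => f (Pi.single i 1), fun x hx => ?_, fun x hx => ?_⟩
    · rw [← hf]; exact hL _ (Submodule.subset_span ⟨x, hx, rfl⟩)
    · rw [← hf]; exact (h1 _ (subset_convexHull ℝ _ ⟨x, hx, rfl⟩)).trans (huv.trans hv)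
  · exfalso
    obtain ⟨y, hyC, hyL⟩ := Set.not_disjoint_iff.1 hd
    have e1 : ∃ l : X → ℝ, (∀ x, 0 ≤ l x) ∧ (∀ x, p x ≠ 0 → l x = 0) ∧ (∑ x, l x = 1) ∧
        ∑ x, l x • a x = y := by
      have hsub : C ⊆ {y | ∃ l : X → ℝ, (∀ x, 0 ≤ l x) ∧ (∀ x, p x ≠ 0 → l x = 0) ∧
          (∑ x, l x = 1) ∧ ∑ x, l x • a x = y} := by
        refine convexHull_min ?_ ?_
        · rintro _ ⟨x, hx, rfl⟩
          refine ⟨Pi.single x 1, fun z => ?_, fun z hz => ?_, ?_, ?_⟩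
          · by_cases h : z = x <;> simp [Pi.single_apply, h]
          · have : z ≠ x := by rintro rfl; exact hz hx
            simp [this]
          · simp
          · rw [Finset.sum_eq_single x] <;> simp +contextual
        · rintro _ ⟨l, a1, a2, a3, rfl⟩ _ ⟨l', b1, b2, b3, rfl⟩ s t hs ht hst
          refine ⟨s • l + t • l', fun z => ?_, fun z hz => ?_, ?_, ?_⟩
          · have := a1 z; have := b1 z
            simp only [Pi.add_apply, Pi.smul_apply, smul_eq_mul]; positivity
          · simp [a2 z hz, b2 z hz]
          · simp [Finset.sum_add_distrib, ← Finset.mul_sum, a3, b3, hst]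
          · simp [Finset.sum_add_distrib, Finset.smul_sum, add_smul, mul_smul]
      exact hsub hyC
    have e2 : ∃ r : X → ℝ, (∀ x, p x = 0 → r x = 0) ∧ ∑ x, r x • a x = y := by
      refine Submodule.span_induction (p := fun y _ => ∃ r : X → ℝ, (∀ x, p x = 0 → r x = 0) ∧
        ∑ x, r x • a x = y) ?_ ?_ ?_ ?_ hyL
      · rintro _ ⟨x, hx, rfl⟩
        refine ⟨Pi.single x 1, fun z hz => ?_, ?_⟩
        · have : z ≠ x := by rintro rfl; exact hx hz
          simp [this]
        · rw [Finset.sum_eq_single x] <;> simp +contextual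
      · exact ⟨0, by simp, by simp⟩
      · rintro _ _ _ _ ⟨r, h1, rfl⟩ ⟨r', h2, rfl⟩
        exact ⟨r + r', fun x hx => by simp [h1 x hx, h2 x hx],
          by simp [add_smul, Finset.sum_add_distrib]⟩
      · rintro c _ _ ⟨r, h1, rfl⟩
        exact ⟨c • r, fun x hx => by simp [h1 x hx], by simp [mul_smul, Finset.smul_sum]⟩
    obtain ⟨l, l1, l2, l3, l4⟩ := e1
    obtain ⟨r, r1, r2⟩ := e2
    have hker : ∀ i, ∑ x, (A i x : ℝ) * (l - r) x = 0 := by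
      intro i
      have h1 := congrFun (l4.trans r2.symm) i
      simp only [Finset.sum_apply, Pi.smul_apply, smul_eq_mul, a] at h1
      simp only [Pi.sub_apply, mul_sub, Finset.sum_sub_distrib, sub_eq_zero]
      simpa [mul_comm] using h1
    obtain ⟨k, N, hN, hkU, hkc, hk0⟩ := aux_approx (l - r)
      {u | ∀ x, 0 < (l - r) x → 0 < u x} (by
        simp only [Set.setOf_forall]
        refine isOpen_iInter_of_finite fun x => isOpen_iInter_of_finite fun _ => ?_
        exact isOpen_lt continuous_const (continuous_apply x)) (fun x hx => hx)
    have hbk := hb k (fun i => hkc (fun x => A i x) (by simpa using hker i))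
    have hN' : (0 : ℝ) < N := by exact_mod_cast hN
    have hkpos : ∀ x, 0 < (l - r) x → 0 < k x := by
      intro x hx
      have := hkU x hx
      have h := (div_pos_iff_of_pos_right hN').1 this
      exact_mod_cast h
    obtain ⟨x0, hx0⟩ : ∃ x, l x ≠ 0 := by
      by_contra! h
      simp [h] at l3
    have hp0 : p x0 = 0 := by
      by_contra h; exact hx0 (l2 x0 h)
    have hk1 : 0 < k x0 := hkpos x0 (by
      simp only [Pi.sub_apply, r1 x0 hp0, sub_zero]
      exact lt_of_le_of_ne (l1 x0) hx0.symm)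
    rw [Finset.prod_eq_zero (i := x0) (by simp [hk1]) (by
      rw [hp0]; exact zero_pow (by omega))] at hbk
    refine (Finset.prod_ne_zero_iff.2 ?_) hbk.symm
    intro x hx
    have hx' := (Finset.mem_filter.1 hx).2
    refine pow_ne_zero _ fun h => ?_
    rcases (l1 x).eq_or_lt with h' | h'
    · have := hk0 x (by simp [r1 x h, ← h'])
      omega
    · have := hkpos x (by simp [r1 x h, h'])
      omega


/-- The intersection of the toric variety of `A` with the probability simplex
(nonnegative `p` with `∑ p μ = 1` satisfying all binomial equations coming from integer
vectors in the kernel of `A`) equals the closure (in `ℝ^X`) of the interior of the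
`A`-model. -/
theorem stmt2 {X : Type*} [Fintype X] [Nonempty X]
    (μ : X → ℝ) (hμ : ∀ x, 0 < μ x)
    (m : ℕ) (A : Fin (m + 1) → X → ℕ) (hA0 : ∀ x, A 0 x = 1) :
    {p : X → ℝ | (∀ x, 0 ≤ p x) ∧ (∑ x, p x * μ x = 1) ∧
        ∀ k : X → ℤ, (∀ i, ∑ x, k x * (A i x : ℤ) = 0) →
          (∏ x ∈ Finset.univ.filter (fun x => 0 < k x), p x ^ (k x).toNat)
            = ∏ x ∈ Finset.univ.filter (fun x => k x < 0), p x ^ (-k x).toNat}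
      = closure {p : X → ℝ | ∃ t : Fin (m + 1) → ℝ, (∀ i, 0 < t i) ∧
          p = fun x => (∏ i, t i ^ A i x) / ∑ y, (∏ i, t i ^ A i y) * μ y} := by
  classical
  apply Set.Subset.antisymm
  · rintro p ⟨hp, hs, hb⟩
    obtain ⟨θ, hθ⟩ := aux_log m A p hp hb
    obtain ⟨w, hw0, hw1⟩ := aux_face m A p hb
    let t : ℝ → Fin (m + 1) → ℝ := fun s i => Real.exp (θ i + s * w i)
    have hq : ∀ s x, ∏ i, t s i ^ A i x =
        Real.exp (∑ i, θ i * A i x) * Real.exp (s * ∑ i, w i * A i x) := by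
      intro s x
      rw [← Real.exp_add, Finset.mul_sum, ← Finset.sum_add_distrib, Real.exp_sum]
      refine Finset.prod_congr rfl fun i _ => ?_
      rw [← Real.exp_nat_mul]
      congr 1; ring
    have hlim : ∀ x, Filter.Tendsto (fun s => ∏ i, t s i ^ A i x) Filter.atTop (nhds (p x)) := by
      intro x
      simp only [hq]
      by_cases hx : p x = 0
      · rw [hx]
        have h1 : Filter.Tendsto (fun s : ℝ => s * ∑ i, w i * (A i x : ℝ)) Filter.atTop
            Filter.atBot := Filter.tendsto_id.atTop_mul_const_of_neg (hw1 x hx)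
        simpa using (Real.tendsto_exp_atBot.comp h1).const_mul (Real.exp (∑ i, θ i * A i x))
      · simp only [hw0 x hx, ← hθ x hx]
        rw [Real.exp_log (lt_of_le_of_ne (hp x) (Ne.symm hx))]
        simp
    have hZ : Filter.Tendsto (fun s => ∑ y, (∏ i, t s i ^ A i y) * μ y) Filter.atTop
        (nhds 1) := by
      rw [← hs]
      exact tendsto_finsetSum _ fun x _ => (hlim x).mul_const _
    refine mem_closure_of_tendsto (f := fun s x => (∏ i, t s i ^ A i x) /
      ∑ y, (∏ i, t s i ^ A i y) * μ y) (b := Filter.atTop) ?_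
      (Filter.Eventually.of_forall fun s => ⟨t s, fun i => Real.exp_pos _, rfl⟩)
    refine tendsto_pi_nhds.2 fun x => ?_
    have := (hlim x).div hZ one_ne_zero
    rw [div_one] at this
    exact this
  · refine closure_minimal ?_ ?_
    · rintro _ ⟨t, ht, rfl⟩
      have hq : ∀ x, 0 < ∏ i, t i ^ A i x := fun x => Finset.prod_pos fun i _ => pow_pos (ht i) _
      have hZ : 0 < ∑ y, (∏ i, t i ^ A i y) * μ y :=
        Finset.sum_pos (fun y _ => mul_pos (hq y) (hμ y)) Finset.univ_nonempty
      refine ⟨fun x => (div_pos (hq x) hZ).le, ?_, ?_⟩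
      · simp only [div_mul_eq_mul_div]
        rw [← Finset.sum_div, div_self hZ.ne']
      · intro k hk
        rw [aux_binom _ _ (fun x _ => div_pos (hq x) hZ)]
        have hk' : ∀ i, ∑ x, (k x : ℝ) * A i x = 0 := fun i => by exact_mod_cast hk i
        have h0 : ∑ x, (k x : ℝ) = 0 := by simpa [hA0] using hk' 0
        have hl : ∀ x, Real.log ((∏ i, t i ^ A i x) / ∑ y, (∏ i, t i ^ A i y) * μ y) =
            (∑ i, A i x * Real.log (t i)) - Real.log (∑ y, (∏ i, t i ^ A i y) * μ y) := by
          intro x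
          rw [Real.log_div (hq x).ne' hZ.ne', Real.log_prod (fun i _ => (pow_pos (ht i) _).ne')]
          simp only [Real.log_pow]
        simp only [hl, mul_sub, Finset.sum_sub_distrib]
        rw [← Finset.sum_mul, h0, zero_mul, sub_zero]
        simp only [Finset.mul_sum]
        rw [Finset.sum_comm]
        refine Finset.sum_eq_zero fun i _ => ?_
        simp only [← mul_assoc]
        rw [← Finset.sum_mul, hk', zero_mul]
    · simp only [Set.setOf_and, Set.setOf_forall]
      refine IsClosed.inter ?_ (IsClosed.inter ?_ ?_)
      · exact isClosed_iInter fun x => isClosed_le continuous_const (continuous_apply x)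
      · exact isClosed_eq (by fun_prop) continuous_const
      · exact isClosed_iInter fun k => isClosed_iInter fun _ =>
          isClosed_eq (by fun_prop) (by fun_prop)
end

section
/- Let A be a model matrix on a finite sample space X with first row identically 1, μ a strictly positive reference measure, and let H be a matrix with rows H_1,…,H_h ∈ ℤ_{≥0}^X that generate the additive monoid ℤ_{≥0}^X ∩ RowSpan(A) (i.e. every nonnegative integer vector lying in the real row span of A is an ℕ-linear combination of the rows of H). Then the set of densities of the H-model (densities p_H(·;s), s ∈ ℝ_{≥0}^h, defined whenever the unnormalized density q_H(x;s) = ∏_{j=1}^h s_j^{H_j(x)} is not identically zero) equals the closure in ℝ^X of the interior of the A-model; in particular every density of the H-model is a limit of a sequence of densities of the A-model. -/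
open Filter Topology in
theorem rat_aux {X ι : Type*} [Fintype X] [Fintype ι] (A : ι → X → ℕ) (c : ι → ℝ) (F : Set X)
    (hF : ∀ x ∈ F, ∑ i, c i * (A i x : ℝ) = 0)
    (hpos : ∀ x, x ∉ F → 0 < ∑ i, c i * (A i x : ℝ)) :
    ∃ u : X → ℕ, (∃ e : ι → ℝ, ∀ x, (u x : ℝ) = ∑ i, e i * (A i x : ℝ)) ∧
      (∀ x ∈ F, u x = 0) ∧ ∀ x, x ∉ F → 0 < u x := by
  classical
  let S := Submodule.span ℚ (Set.range c)
  have : Module.Finite ℚ S := FiniteDimensional.span_of_finite ℚ (Set.finite_range c)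
  let b := Module.finBasis ℚ S
  let cs : ι → S := fun i => ⟨c i, Submodule.subset_span ⟨i, rfl⟩⟩
  let r : ι → Fin (Module.finrank ℚ S) → ℚ := fun i l => b.repr (cs i) l
  have hc : ∀ i, c i = ∑ l, (r i l : ℝ) * (b l : ℝ) := by
    intro i
    have h1 := congrArg (Subtype.val) (b.sum_repr (cs i))
    rw [← show ((cs i : S) : ℝ) = c i from rfl, ← h1]
    simp only [Submodule.coe_sum, Submodule.coe_smul, Rat.smul_def, r]
  have hr : ∀ x ∈ F, ∀ l, ∑ i, r i l * (A i x : ℚ) = 0 := by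
    intro x hx l
    have h0 : ∑ i, (A i x : ℚ) • cs i = 0 := by
      apply Subtype.ext
      have := hF x hx
      simp only [Submodule.coe_sum, Submodule.coe_smul, Rat.smul_def, Submodule.coe_zero]
      rw [← this]
      apply Finset.sum_congr rfl
      intro i _
      simp [cs, mul_comm]
    have h1 := congrArg (fun v => b.repr v l) h0
    simp only [map_sum, map_smul, Finsupp.coe_finsetSum, Finset.sum_apply, Finsupp.smul_apply,
      map_zero, Finsupp.coe_zero, Pi.zero_apply, smul_eq_mul] at h1
    rw [← h1]
    apply Finset.sum_congr rfl
    intro i _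
    simp [r, mul_comm]
  let G : (Fin (Module.finrank ℚ S) → ℝ) → X → ℝ :=
    fun β x => ∑ i, (∑ l, (r i l : ℝ) * β l) * (A i x : ℝ)
  have hGc : ∀ x, Continuous fun β => G β x := by
    intro x; simp only [G]; fun_prop
  have hopen : IsOpen {β | ∀ x, x ∉ F → 0 < G β x} := by
    simp only [Set.ofPred_forall]
    refine isOpen_iInter_of_finite fun x => isOpen_iInter_of_finite fun _ => ?_
    exact isOpen_lt continuous_const (hGc x)
  have hd : DenseRange (Pi.map (fun (_ : Fin (Module.finrank ℚ S)) => ((↑) : ℚ → ℝ))) :=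
    DenseRange.piMap fun _ => Rat.denseRange_cast
  obtain ⟨β, hβ⟩ := hd.exists_mem_open hopen ⟨fun l => (b l : ℝ), by
    intro x hx
    have := hpos x hx
    simpa only [G, ← hc] using this⟩
  let ρ : X → ℚ := fun x => ∑ i, (∑ l, r i l * β l) * (A i x : ℚ)
  have hρG : ∀ x, ((ρ x : ℚ) : ℝ) = G (Pi.map (fun _ => ((↑) : ℚ → ℝ)) β) x := by
    intro x; simp [ρ, G]
  have hρpos : ∀ x, x ∉ F → 0 < ρ x := by
    intro x hx
    have := hβ x hx
    rw [← hρG] at this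
    exact_mod_cast this
  have hρ0 : ∀ x ∈ F, ρ x = 0 := by
    intro x hx
    have : ρ x = ∑ l, β l * ∑ i, r i l * (A i x : ℚ) := by
      simp only [ρ, Finset.sum_mul, Finset.mul_sum]
      rw [Finset.sum_comm]
      refine Finset.sum_congr rfl fun _ _ => Finset.sum_congr rfl fun _ _ => by ring
    rw [this]
    exact Finset.sum_eq_zero fun l _ => by rw [hr x hx l, mul_zero]
  have hρnn : ∀ x, 0 ≤ ρ x := by
    intro x
    by_cases hx : x ∈ F
    · exact (hρ0 x hx).ge
    · exact (hρpos x hx).le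
  let D : ℕ := ∏ x, (ρ x).den
  have hD : 0 < D := Finset.prod_pos fun x _ => (ρ x).den_pos
  have hk : ∀ x, ∃ k, D = (ρ x).den * k := fun x =>
    Finset.dvd_prod_of_mem (fun x => (ρ x).den) (Finset.mem_univ x)
  choose k hk using hk
  let u : X → ℕ := fun x => (ρ x).num.toNat * k x
  have hu : ∀ x, (u x : ℚ) = D * ρ x := by
    intro x
    have h1 : (((ρ x).num.toNat : ℕ) : ℚ) = (ρ x).num := by
      have : (((ρ x).num.toNat : ℕ) : ℤ) = (ρ x).num :=
        Int.toNat_of_nonneg (Rat.num_nonneg.2 (hρnn x))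
      exact_mod_cast this
    have h2 : (ρ x) * (ρ x).den = (ρ x).num := Rat.mul_den_eq_num _
    rw [hk x]
    simp only [u]
    push_cast
    rw [h1, ← h2]; ring
  have hDq : (0 : ℚ) < D := by exact_mod_cast hD
  refine ⟨u, ⟨fun i => (D : ℝ) * ∑ l, (r i l : ℝ) * (β l : ℝ), fun x => ?_⟩, fun x hx => ?_,
    fun x hx => ?_⟩
  · have : (u x : ℝ) = D * ((ρ x : ℚ) : ℝ) := by exact_mod_cast congrArg (fun q : ℚ => (q : ℝ)) (hu x)
    rw [this]
    simp only [ρ]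
    push_cast
    rw [Finset.mul_sum]
    exact Finset.sum_congr rfl fun _ _ => by ring
  · have := hu x
    rw [hρ0 x hx, mul_zero] at this
    exact_mod_cast this
  · have : (0 : ℚ) < u x := by rw [hu x]; exact mul_pos hDq (hρpos x hx)
    exact_mod_cast this

theorem span_aux {X ι : Type*} [Fintype ι] (A : ι → X → ℕ) (v : X → ℝ) :
    v ∈ Submodule.span ℝ (Set.range fun i => fun x => (A i x : ℝ)) ↔
      ∃ e : ι → ℝ, ∀ x, v x = ∑ i, e i * (A i x : ℝ) := by
  rw [Submodule.mem_span_range_iff_exists_fun]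
  refine exists_congr fun e => ?_
  rw [funext_iff]
  refine forall_congr' fun x => ?_
  simp [Finset.sum_apply, eq_comm]

theorem prod_exp_aux {X ι : Type*} [Fintype ι] (A : ι → X → ℕ) (c : ι → ℝ) (x : X) :
    ∏ i, Real.exp (c i) ^ A i x = Real.exp (∑ i, c i * (A i x : ℝ)) := by
  rw [Real.exp_sum]
  refine Finset.prod_congr rfl fun i _ => ?_
  rw [← Real.exp_nat_mul, mul_comm]

open Filter Topology in
theorem lim_aux {X ι : Type*} [Fintype X] [Fintype ι] (A : ι → X → ℕ) (p : X → ℝ)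
    (hp : ∀ x, 0 ≤ p x)
    (c : ℕ → ι → ℝ)
    (hlim : Tendsto (fun n x => Real.exp (∑ i, c n i * (A i x : ℝ))) atTop (𝓝 p)) :
    (∃ e : ι → ℝ, ∀ x, p x ≠ 0 → p x = Real.exp (∑ i, e i * (A i x : ℝ))) ∧
    ∃ e : ι → ℝ, (∀ x, p x ≠ 0 → ∑ i, e i * (A i x : ℝ) = 0) ∧
      ∀ x, p x = 0 → 0 < ∑ i, e i * (A i x : ℝ) := by
  classical
  rw [tendsto_pi_nhds] at hlim
  let T : (ι → ℝ) →ₗ[ℝ] (X → ℝ) :=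
    { toFun := fun c x => ∑ i, c i * (A i x : ℝ)
      map_add' := by
        intro a b; ext x; simp [add_mul, Finset.sum_add_distrib]
      map_smul' := by
        intro a b; ext x; simp [Finset.mul_sum, mul_assoc] }
  let R : (ι → ℝ) →ₗ[ℝ] ({x // p x ≠ 0} → ℝ) := (LinearMap.funLeft ℝ ℝ Subtype.val).comp T
  have hR : ∀ a x, R a x = ∑ i, a i * (A i x.1 : ℝ) := fun a x => rfl
  obtain ⟨g, hg⟩ := R.rangeRestrict.exists_rightInverse_of_surjective R.range_rangeRestrict
  have hgc : Continuous g := g.continuous_of_finiteDimensional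
  let y : {x // p x ≠ 0} → ℝ := fun x => Real.log (p x)
  have hy : Tendsto (fun n => R (c n)) atTop (𝓝 y) := by
    rw [tendsto_pi_nhds]
    intro x
    have := (hlim x.1).log x.2
    simpa [Real.log_exp, hR] using this
  have hymem : y ∈ LinearMap.range R :=
    (Submodule.closed_of_finiteDimensional (LinearMap.range R)).mem_of_tendsto hy
      (Eventually.of_forall fun n => ⟨c n, rfl⟩)
  have hy' : Tendsto (fun n => R.rangeRestrict (c n)) atTop (𝓝 ⟨y, hymem⟩) :=
    tendsto_subtype_rng.2 hy
  have hgy := (hgc.tendsto _).comp hy'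
  have hRg : ∀ z, R (g z) = z := by
    intro z
    have := congrArg Subtype.val (LinearMap.congr_fun hg z)
    simpa using this
  refine ⟨⟨g ⟨y, hymem⟩, fun x hx => ?_⟩, ?_⟩
  · have := congrFun (hRg ⟨y, hymem⟩) ⟨x, hx⟩
    rw [hR] at this
    rw [this]
    exact (Real.exp_log (lt_of_le_of_ne (hp x) (Ne.symm hx))).symm
  · have hev : ∀ᶠ n in atTop, ∀ x, p x = 0 →
        0 < T (g (R.rangeRestrict (c n)) - c n) x := by
      rw [eventually_all]
      intro x
      by_cases hx : p x = 0
      · have hT : Continuous fun a => T a x :=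
          (continuous_apply x).comp T.continuous_of_finiteDimensional
        have h1 : Tendsto (fun n => T (g (R.rangeRestrict (c n))) x) atTop
            (𝓝 (T (g ⟨y, hymem⟩) x)) := (hT.tendsto _).comp hgy
        have h2 : Tendsto (fun n => T (c n) x) atTop atBot := by
          have := hlim x
          rw [hx] at this
          exact Real.tendsto_exp_comp_nhds_zero.1 this
        have h3 := h1.add_atTop (tendsto_neg_atBot_atTop.comp h2)
        filter_upwards [h3.eventually_gt_atTop 0] with n hn _
        rw [map_sub]
        simpa [sub_eq_add_neg] using hn
      · exact Eventually.of_forall fun n h => absurd h hx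
    obtain ⟨n, hn⟩ := hev.exists
    refine ⟨g (R.rangeRestrict (c n)) - c n, fun x hx => ?_, hn⟩
    have : R (g (R.rangeRestrict (c n)) - c n) ⟨x, hx⟩ = 0 := by
      rw [map_sub, hRg]; simp
    rwa [hR] at this

/-- If the rows of `H` generate the additive monoid `ℤ_{≥0}^X ∩ RowSpan(A)`,
then the set of densities of the `H`-model equals the closure of the interior of the
`A`-model. -/
theorem stmt3 {X : Type*} [Fintype X] [Nonempty X]
    (μ : X → ℝ) (hμ : ∀ x, 0 < μ x)
    (m : ℕ) (A : Fin (m + 1) → X → ℕ) (hA0 : ∀ x, A 0 x = 1)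
    (h : ℕ) (H : Fin h → X → ℕ)
    (hHmem : ∀ j, (fun x => (H j x : ℝ)) ∈
        Submodule.span ℝ (Set.range fun i => fun x => (A i x : ℝ)))
    (hgen : ∀ u : X → ℕ,
        (fun x => (u x : ℝ)) ∈ Submodule.span ℝ (Set.range fun i => fun x => (A i x : ℝ)) →
        ∃ lam : Fin h → ℕ, ∀ x, u x = ∑ j, lam j * H j x) :
    {p : X → ℝ | ∃ s : Fin h → ℝ, (∀ j, 0 ≤ s j) ∧ (∃ x, (∏ j, s j ^ H j x) ≠ 0) ∧
        p = fun x => (∏ j, s j ^ H j x) / ∑ y, (∏ j, s j ^ H j y) * μ y}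
      = closure {p : X → ℝ | ∃ t : Fin (m + 1) → ℝ, (∀ i, 0 < t i) ∧
          p = fun x => (∏ i, t i ^ A i x) / ∑ y, (∏ i, t i ^ A i y) * μ y} := by
  classical
  have hA : ∀ i, ∃ lam : Fin h → ℕ, ∀ x, A i x = ∑ j, lam j * H j x := fun i =>
    hgen (A i) (Submodule.subset_span ⟨i, rfl⟩)
  choose lam hlam using hA
  apply Set.Subset.antisymm
  · rintro p ⟨s, hs, ⟨x0, hx0⟩, rfl⟩
    have hZ : (∑ y, (∏ j, s j ^ H j y) * μ y) ≠ 0 := by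
      have hq : ∀ y, 0 ≤ ∏ j, s j ^ H j y := fun y =>
        Finset.prod_nonneg fun j _ => pow_nonneg (hs j) _
      refine ne_of_gt (Finset.sum_pos' (fun y _ => mul_nonneg (hq y) (hμ y).le)
        ⟨x0, Finset.mem_univ _, mul_pos (lt_of_le_of_ne (hq x0) hx0.symm) (hμ x0)⟩)
    have hcont : ContinuousAt (fun (ε : ℝ) x => (∏ j, (s j + ε) ^ H j x) /
        ∑ y, (∏ j, (s j + ε) ^ H j y) * μ y) 0 := by
      rw [continuousAt_pi]
      intro x
      refine ContinuousAt.div (by fun_prop) (by fun_prop) ?_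
      simpa using hZ
    have ht : Filter.Tendsto (fun (ε : ℝ) x => (∏ j, (s j + ε) ^ H j x) /
        ∑ y, (∏ j, (s j + ε) ^ H j y) * μ y) (nhdsWithin 0 (Set.Ioi 0))
        (nhds (fun x => (∏ j, s j ^ H j x) / ∑ y, (∏ j, s j ^ H j y) * μ y)) := by
      have := hcont.tendsto.mono_left (nhdsWithin_le_nhds (s := Set.Ioi (0 : ℝ)))
      simpa only [add_zero] using this
    refine mem_closure_of_tendsto ht ?_
    filter_upwards [self_mem_nhdsWithin] with ε hε
    have hpos : ∀ j, 0 < s j + ε := fun j => add_pos_of_nonneg_of_pos (hs j) hε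
    have hmem : (fun x => ∑ j, Real.log (s j + ε) * (H j x : ℝ)) ∈
        Submodule.span ℝ (Set.range fun i => fun x => (A i x : ℝ)) := by
      have : (fun x => ∑ j, Real.log (s j + ε) * (H j x : ℝ)) =
          ∑ j, Real.log (s j + ε) • (fun x => (H j x : ℝ)) := by
        ext x; simp [Finset.sum_apply]
      rw [this]
      exact Submodule.sum_mem _ fun j _ => Submodule.smul_mem _ _ (hHmem j)
    obtain ⟨e, he⟩ := (span_aux A _).1 hmem
    have hq : ∀ x, ∏ j, (s j + ε) ^ H j x = ∏ i, Real.exp (e i) ^ A i x := by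
      intro x
      rw [prod_exp_aux, ← he x, ← prod_exp_aux]
      exact Finset.prod_congr rfl fun j _ => by rw [Real.exp_log (hpos j)]
    exact ⟨fun i => Real.exp (e i), fun i => Real.exp_pos _, by simp only [hq]⟩
  · intro p hp
    obtain ⟨P, hP, hlim⟩ := mem_closure_iff_seq_limit.1 hp
    have hstep : ∀ n, (∑ x, P n x * μ x = 1) ∧
        ∃ c : Fin (m + 1) → ℝ, P n = fun x => Real.exp (∑ i, c i * (A i x : ℝ)) := by
      intro n
      obtain ⟨t, ht, hPn⟩ := hP n
      have hqpos : ∀ x, 0 < ∏ i, t i ^ A i x := fun x =>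
        Finset.prod_pos fun i _ => pow_pos (ht i) _
      have hZ : 0 < ∑ y, (∏ i, t i ^ A i y) * μ y :=
        Finset.sum_pos (fun y _ => mul_pos (hqpos y) (hμ y)) Finset.univ_nonempty
      generalize hZd : ∑ y, (∏ i, t i ^ A i y) * μ y = Z at *
      constructor
      · rw [hPn]
        simp only [div_mul_eq_mul_div]
        rw [← Finset.sum_div, hZd, div_self hZ.ne']
      · refine ⟨fun i => Real.log (t i) - if i = 0 then Real.log Z else 0, ?_⟩
        rw [hPn]
        ext x
        simp only [sub_mul, Finset.sum_sub_distrib, ite_mul, zero_mul, Finset.sum_ite_eq',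
          Finset.mem_univ, if_true, hA0, Nat.cast_one, mul_one]
        rw [Real.exp_sub, Real.exp_log hZ, ← prod_exp_aux]
        congr 1
        exact Finset.prod_congr rfl fun i _ => by rw [Real.exp_log (ht i)]
    choose hsum c hc using hstep
    have hpl := tendsto_pi_nhds.1 hlim
    have hp0 : ∀ x, 0 ≤ p x := fun x =>
      ge_of_tendsto' (hpl x) fun n => by rw [hc n]; exact (Real.exp_pos _).le
    have hp1 : ∑ x, p x * μ x = 1 := by
      have h1 : Filter.Tendsto (fun n => ∑ x, P n x * μ x) Filter.atTop
          (nhds (∑ x, p x * μ x)) :=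
        tendsto_finsetSum _ fun x _ => (hpl x).mul_const _
      simp only [hsum] at h1
      exact tendsto_nhds_unique h1 tendsto_const_nhds
    have hlim' : Filter.Tendsto (fun n x => Real.exp (∑ i, c n i * (A i x : ℝ))) Filter.atTop
        (nhds p) := by
      have : (fun n x => Real.exp (∑ i, c n i * (A i x : ℝ))) = P := by
        ext n x; rw [hc n]
      rwa [this]
    obtain ⟨⟨e, he⟩, w, hw0, hwpos⟩ := lim_aux A p hp0 c hlim'
    obtain ⟨u, hue, hu0, hupos⟩ := rat_aux A w {x | p x ≠ 0} hw0
      (fun x hx => hwpos x (by simpa using hx))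
    obtain ⟨l, hl⟩ := hgen u ((span_aux A _).2 hue)
    let d : Fin h → ℝ := fun j => ∑ i, e i * (lam i j : ℝ)
    have hd : ∀ x, ∑ j, d j * (H j x : ℝ) = ∑ i, e i * (A i x : ℝ) := by
      intro x
      simp only [d, hlam, Finset.sum_mul]
      push_cast
      simp only [Finset.mul_sum]
      rw [Finset.sum_comm]
      exact Finset.sum_congr rfl fun _ _ => Finset.sum_congr rfl fun _ _ => by ring
    let s : Fin h → ℝ := fun j => if ∀ x, p x ≠ 0 → H j x = 0 then 0 else Real.exp (d j)
    have hq : ∀ x, ∏ j, s j ^ H j x = p x := by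
      intro x
      by_cases hx : p x = 0
      · rw [hx]
        have hux : 0 < u x := hupos x (by simpa using hx)
        rw [hl x] at hux
        obtain ⟨j, -, hj⟩ := Finset.exists_ne_zero_of_sum_ne_zero hux.ne'
        have hlj : l j ≠ 0 := left_ne_zero_of_mul hj
        have hHj : H j x ≠ 0 := right_ne_zero_of_mul hj
        refine Finset.prod_eq_zero (Finset.mem_univ j) ?_
        have : ∀ x, p x ≠ 0 → H j x = 0 := by
          intro z hz
          have h1 := hu0 z hz
          rw [hl z, Finset.sum_eq_zero_iff] at h1
          exact (mul_eq_zero.1 (h1 j (Finset.mem_univ j))).resolve_left hlj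
        simp only [s, if_pos this]
        exact zero_pow hHj
      · rw [he x hx, ← hd, ← prod_exp_aux]
        refine Finset.prod_congr rfl fun j _ => ?_
        by_cases hj : ∀ x, p x ≠ 0 → H j x = 0
        · rw [hj x hx, pow_zero, pow_zero]
        · simp only [s, if_neg hj]
    refine ⟨s, fun j => ?_, ?_, ?_⟩
    · simp only [s]; split_ifs
      · exact le_rfl
      · exact (Real.exp_pos _).le
    · simp only [hq]
      by_contra hcon
      push Not at hcon
      simp [hcon] at hp1
    · simp only [hq, hp1, div_one]
end

section
/- Let V be a finite set and N ∈ ℤ_{≥0}^{V×V} a nonzero nonnegative integer matrix. Then N is the transition count N(ω) of some trajectory ω = v_0 v_1 ⋯ v_n (i.e. N_{v→w} = #{k ∈ {1,…,n} : v_{k-1} = v, v_k = w} for all v, w) if, and only if, (a) the support of N is connected, meaning the undirected graph on the vertices incident to some pair (v,w) with N_{v→w} > 0, with an edge between v and w whenever N_{v→w} > 0 or N_{w→v} > 0, is connected; and (b) the divergence d(v) = Σ_w N_{v→w} − Σ_w N_{w→v} is either identically 0 on V, or there exist two distinct vertices v_0 ≠ v_n with d(v_0) = +1, d(v_n) = −1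 and d(v) = 0 for all other v. -/
/-- The transition count of the trajectory `ω = ω_0 ω_1 ⋯ ω_n`. -/
def transCount {V : Type*} [DecidableEq V] {n : ℕ} (ω : Fin (n + 1) → V) (v w : V) : ℕ :=
  (Finset.univ.filter (fun k : Fin n => ω k.castSucc = v ∧ ω k.succ = w)).card


def eE {V : Type*} [DecidableEq V] (a b : V) : V → V → ℕ :=
  fun v w => if a = v ∧ b = w then 1 else 0

inductive Tr {V : Type*} [DecidableEq V] : (V → V → ℕ) → V → V → Prop
  | nil (a : V) : Tr 0 a a
  | cons (a b c : V) (M : V → V → ℕ) (h : Tr M b c) : Tr (eE a b + M) a c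

def dv {V : Type*} [Fintype V] (K : V → V → ℕ) (v : V) : ℤ :=
  (∑ w, (K v w : ℤ)) - ∑ w, (K w v : ℤ)

def dl {V : Type*} [DecidableEq V] (a v : V) : ℤ := if a = v then 1 else 0

section
variable {V : Type*} [DecidableEq V]

theorem dv_add [Fintype V] (K L : V → V → ℕ) (v : V) : dv (K + L) v = dv K v + dv L v := by
  simp only [dv, Pi.add_apply, Nat.cast_add, Finset.sum_add_distrib]; ring

theorem dv_eE [Fintype V] (a b v : V) : dv (eE a b) v = dl a v - dl b v := by
  simp only [dv, eE, dl]
  by_cases h1 : a = v <;> by_cases h2 : b = v <;> simp [h1, h2]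

theorem dv_Tr [Fintype V] {M : V → V → ℕ} {a b : V} (h : Tr M a b) (v : V) :
    dv M v = dl a v - dl b v := by
  induction h with
  | nil a => simp [dv]
  | cons a b c M h ih => rw [dv_add, ih, dv_eE]; ring

theorem eE_self (a b : V) : eE a b a b = 1 := by simp [eE]

theorem tr_append {M L : V → V → ℕ} {a b c : V} (h : Tr M a b) (h' : Tr L b c) :
    Tr (M + L) a c := by
  induction h with
  | nil a => simpa using h'
  | cons a b c M h ih => rw [add_assoc]; exact Tr.cons _ _ _ _ (ih h')

theorem eE_ne {a b v w : V} (h : eE a b v w ≠ 0) : a = v ∧ b = w := by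
  by_contra h'; exact h (by simp [eE, h'])

theorem tr_splice {M C : V → V → ℕ} {a b v : V} (h : Tr M a b)
    (hv : v = a ∨ ∃ u, M v u ≠ 0 ∨ M u v ≠ 0) (hC : Tr C v v) : Tr (M + C) a b := by
  induction h with
  | nil a =>
    rcases hv with rfl | ⟨u, hu⟩
    · simpa using hC
    · simp at hu
  | cons a b c M h ih =>
    by_cases hva : v = a
    · subst hva
      rw [add_comm]
      exact tr_append hC (Tr.cons _ _ _ _ h)
    · rw [add_assoc]
      refine Tr.cons _ _ _ _ (ih ?_)
      rcases hv with hv | ⟨u, hu⟩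
      · exact absurd hv hva
      · by_cases hvb : v = b
        · exact Or.inl hvb
        · right
          refine ⟨u, ?_⟩
          have e1 : eE a b v u = 0 := by
            by_contra hh; exact hva (eE_ne hh).1.symm
          have e2 : eE a b u v = 0 := by
            by_contra hh; exact hvb (eE_ne hh).2.symm
          simpa [e1, e2] using hu

theorem split_edge {K : V → V → ℕ} {a c : V} (h : K a c ≠ 0) : ∃ L, K = eE a c + L := by
  refine ⟨K - eE a c, ?_⟩
  funext v w
  simp only [Pi.add_apply, Pi.sub_apply]
  by_cases hh : a = v ∧ c = w
  · obtain ⟨rfl, rfl⟩ := hh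
    rw [eE_self]; omega
  · simp [eE, hh]

def tot [Fintype V] (K : V → V → ℕ) : ℕ := ∑ v, ∑ w, K v w

theorem tot_add [Fintype V] (K L : V → V → ℕ) : tot (K + L) = tot K + tot L := by
  simp [tot, Finset.sum_add_distrib]

theorem tot_pos [Fintype V] {K : V → V → ℕ} {a c : V} (h : K a c ≠ 0) : 0 < tot K := by
  have h1 : K a c ≤ ∑ w, K a w :=
    Finset.single_le_sum (f := fun w => K a w) (fun _ _ => Nat.zero_le _) (Finset.mem_univ c)
  have h2 : (∑ w, K a w) ≤ tot K :=
    Finset.single_le_sum (f := fun v => ∑ w, K v w) (fun _ _ => Nat.zero_le _) (Finset.mem_univ a)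
  omega

theorem greedy [Fintype V] (n : ℕ) : ∀ (K : V → V → ℕ) (a b : V), tot K = n →
    (∀ v, dv K v = dl a v - dl b v) →
    ∃ M L, K = M + L ∧ Tr M a b ∧ ∀ c, K a c ≠ 0 → 0 < tot M := by
  induction n using Nat.strong_induction_on with
  | _ n ih =>
  intro K a b hn hd
  by_cases h : ∃ c, K a c ≠ 0
  · obtain ⟨c, hc⟩ := h
    obtain ⟨L, rfl⟩ := split_edge hc
    have hp : 0 < tot (eE a c) := tot_pos (a := a) (c := c) (by simp [eE_self])
    have ht := tot_add (eE a c) L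
    obtain ⟨M, L', rfl, hM, -⟩ := ih (tot L) (by omega) L c b rfl (by
      intro v
      have := hd v
      rw [dv_add, dv_eE] at this
      linarith)
    refine ⟨eE a c + M, L', by rw [add_assoc], Tr.cons _ _ _ _ hM, fun _ _ => ?_⟩
    rw [tot_add]; omega
  · push Not at h
    have hab : a = b := by
      by_contra hab
      have := hd a
      have h0 : 0 ≤ ∑ w, (K w a : ℤ) := Finset.sum_nonneg (fun _ _ => Int.natCast_nonneg _)
      simp [dv, dl, h, Ne.symm hab] at this
      linarith
    subst hab
    exact ⟨0, K, by simp, Tr.nil a, fun c hc => absurd (h c) hc⟩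

theorem bal_in [Fintype V] {K : V → V → ℕ} {v : V} (hd : dv K v = 0)
    (h : ∀ u, K v u = 0) (u : V) : K u v = 0 := by
  simp only [dv, h] at hd
  have h0 : (∑ w, (K w v : ℤ)) = 0 := by simpa using hd
  have h1 : (∑ w, K w v) = 0 := by exact_mod_cast h0
  exact (Finset.sum_eq_zero_iff.mp h1) u (Finset.mem_univ u)

theorem euler [Fintype V] (N : V → V → ℕ) (a b : V)
    (hconn : ∀ x y, N x y ≠ 0 → Relation.ReflTransGen (fun a b => N a b ≠ 0 ∨ N b a ≠ 0) a x)
    (n : ℕ) : ∀ (M K : V → V → ℕ), tot K = n → N = M + K → Tr M a b → (∀ v, dv K v = 0) →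
      Tr N a b := by
  induction n using Nat.strong_induction_on with
  | _ n ih =>
  intro M K hn hN hM hd
  by_cases hK : ∃ x y, K x y ≠ 0
  · obtain ⟨x, y, hxy⟩ := hK
    have key : ∃ v, (v = a ∨ ∃ u, M v u ≠ 0 ∨ M u v ≠ 0) ∧ ∃ u, K v u ≠ 0 := by
      by_contra hcon
      push Not at hcon
      have hx := hconn x y (by simp [hN, hxy])
      have hvis : (x = a ∨ ∃ u, M x u ≠ 0 ∨ M u x ≠ 0) := by
        clear hxy
        induction hx with
        | refl => exact Or.inl rfl
        | @tail p q _ hpq ihp =>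
          have h1 := hcon p ihp
          have h2 := bal_in (hd p) h1
          right
          refine ⟨p, ?_⟩
          simp only [hN, Pi.add_apply, h1, h2, add_zero] at hpq
          exact hpq.symm
      exact hxy (hcon x hvis y)
    obtain ⟨v, hv, u, hu⟩ := key
    obtain ⟨C, L, rfl, hC, hpos⟩ := greedy (tot K) K v v rfl (by intro w; rw [hd w]; ring)
    have hp := hpos u hu
    have ht := tot_add C L
    refine ih (tot L) (by omega) (M + C) L rfl (by rw [hN, add_assoc]) (tr_splice hM hv hC) ?_
    intro w
    have := hd w
    rw [dv_add, dv_Tr hC] at this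
    linarith
  · push Not at hK
    have : K = 0 := by funext x y; exact hK x y
    rw [hN, this, add_zero]; exact hM

theorem tr_conn {M : V → V → ℕ} {a b : V} (h : Tr M a b) :
    ∀ v, (∃ u, M v u ≠ 0 ∨ M u v ≠ 0) →
      Relation.ReflTransGen (fun a b => M a b ≠ 0 ∨ M b a ≠ 0) a v := by
  induction h with
  | nil a => intro v hv; simp at hv
  | cons a b c M h ih =>
    intro v hv
    by_cases hva : v = a
    · subst hva; exact Relation.ReflTransGen.refl
    have hab : Relation.ReflTransGen
        (fun x y => (eE a b + M) x y ≠ 0 ∨ (eE a b + M) y x ≠ 0) a b :=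
      Relation.ReflTransGen.single (Or.inl (by simp [eE_self]))
    by_cases hvb : v = b
    · subst hvb; exact hab
    refine hab.trans ?_
    refine Relation.ReflTransGen.mono ?_ _ _ (ih v ?_)
    · intro x y hxy
      rcases hxy with hxy | hxy
      · left; simp [hxy]
      · right; simp [hxy]
    · obtain ⟨u, hu⟩ := hv
      refine ⟨u, ?_⟩
      have e1 : eE a b v u = 0 := by
        by_contra hh; exact hva (eE_ne hh).1.symm
      have e2 : eE a b u v = 0 := by
        by_contra hh; exact hvb (eE_ne hh).2.symm
      simpa [e1, e2] using hu

theorem transCount_succ {n : ℕ} (ω : Fin (n + 1 + 1) → V) :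
    transCount ω = eE (ω 0) (ω 1) + transCount (fun k => ω k.succ) := by
  funext v w
  simp only [transCount, Finset.card_filter, Fin.sum_univ_succ, Pi.add_apply, eE]
  simp
  congr

theorem transCount_zero (ω : Fin (0 + 1) → V) : transCount ω = 0 := by
  funext v w
  simp [transCount]

theorem tr_of_traj : ∀ {n : ℕ} (ω : Fin (n + 1) → V), Tr (transCount ω) (ω 0) (ω (Fin.last n))
  | 0, ω => by rw [transCount_zero]; exact Tr.nil _
  | n + 1, ω => by
    rw [transCount_succ]
    have := tr_of_traj (fun k => ω k.succ)
    exact Tr.cons _ _ _ _ this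

theorem traj_of_tr {M : V → V → ℕ} {a b : V} (h : Tr M a b) :
    ∃ (n : ℕ) (ω : Fin (n + 1) → V), ω 0 = a ∧ M = transCount ω := by
  induction h with
  | nil a => exact ⟨0, fun _ => a, rfl, (transCount_zero _).symm⟩
  | cons a b c M h ih =>
    obtain ⟨n, ω, rfl, rfl⟩ := ih
    refine ⟨n + 1, Fin.cons a ω, rfl, ?_⟩
    rw [transCount_succ]
    rfl

end

/-- A nonzero nonnegative integer matrix `N` is the transition count of some
trajectory iff (a) its support is connected and (b) its divergence
`d(v) = ∑_w N_{v→w} − ∑_w N_{w→v}` is identically zero, or equals `+1` at one vertex,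
`−1` at another, and `0` elsewhere. -/
theorem stmt6 {V : Type*} [Fintype V] [DecidableEq V]
    (N : V → V → ℕ) (hN : ∃ v w, N v w ≠ 0) :
    (∃ (n : ℕ) (_ : 1 ≤ n) (ω : Fin (n + 1) → V), ∀ v w, N v w = transCount ω v w)
      ↔ ((∀ v w : V, (∃ u, N v u ≠ 0 ∨ N u v ≠ 0) → (∃ u, N w u ≠ 0 ∨ N u w ≠ 0) →
            Relation.ReflTransGen (fun a b => N a b ≠ 0 ∨ N b a ≠ 0) v w)
        ∧ ((∀ v : V, (∑ w, (N v w : ℤ)) - ∑ w, (N w v : ℤ) = 0)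
            ∨ ∃ v0 vn : V, v0 ≠ vn
              ∧ (∑ w, (N v0 w : ℤ)) - (∑ w, (N w v0 : ℤ)) = 1
              ∧ (∑ w, (N vn w : ℤ)) - (∑ w, (N w vn : ℤ)) = -1
              ∧ ∀ v, v ≠ v0 → v ≠ vn → (∑ w, (N v w : ℤ)) - (∑ w, (N w v : ℤ)) = 0)) := by
  
  constructor
  · rintro ⟨n, -, ω, hω⟩
    have hT : Tr N (ω 0) (ω (Fin.last n)) := by
      have : N = transCount ω := by funext v w; exact hω v w
      rw [this]; exact tr_of_traj ω
    have hd := dv_Tr hT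
    refine ⟨fun v w hv hw => ?_, ?_⟩
    · refine Relation.ReflTransGen.trans ?_ (tr_conn hT w hw)
      haveI : Std.Symm (fun a b => N a b ≠ 0 ∨ N b a ≠ 0) := ⟨fun x y h => h.symm⟩
      exact Relation.ReflTransGen.stdSymm.symm _ _ (tr_conn hT v hv)
    · change (∀ v, dv N v = 0) ∨ ∃ v0 vn : V, v0 ≠ vn ∧ dv N v0 = 1 ∧ dv N vn = -1
        ∧ ∀ v, v ≠ v0 → v ≠ vn → dv N v = 0
      by_cases he : ω 0 = ω (Fin.last n)
      · left; intro v; rw [hd, he]; ring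
      · right
        refine ⟨_, _, he, ?_, ?_, ?_⟩
        · rw [hd]; simp [dl, Ne.symm he]
        · rw [hd]; simp [dl, he]
        · intro v h1 h2; rw [hd]; simp [dl, Ne.symm h1, Ne.symm h2]
  · rintro ⟨hc, hb⟩
    have hT : ∃ a b, Tr N a b := by
      rcases hb with hb | ⟨v0, vn, hne, h0, hn, hz⟩
      · obtain ⟨x, y, hxy⟩ := hN
        refine ⟨x, x, euler N x x ?_ _ 0 N rfl (by simp) (Tr.nil x) hb⟩
        intro p q hpq
        exact hc _ _ ⟨y, Or.inl hxy⟩ ⟨q, Or.inl hpq⟩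
      · have hd : ∀ v, dv N v = dl v0 v - dl vn v := by
          intro v
          by_cases e0 : v = v0
          · subst e0; simp [dl, Ne.symm hne]; exact h0
          by_cases en : v = vn
          · subst en; simp [dl, hne]; exact hn
          simp [dl, Ne.symm e0, Ne.symm en]; exact hz v e0 en
        have hs : ∃ u, N v0 u ≠ 0 := by
          by_contra hcon
          push Not at hcon
          have hp : 0 ≤ ∑ w, (N w v0 : ℤ) := Finset.sum_nonneg (fun _ _ => Int.natCast_nonneg _)
          simp [hcon] at h0
          linarith
        obtain ⟨u, hu⟩ := hs
        obtain ⟨M, L, hML, hM, -⟩ := greedy _ N v0 vn rfl hd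
        refine ⟨v0, vn, euler N v0 vn ?_ _ M L rfl hML hM ?_⟩
        · intro p q hpq
          exact hc _ _ ⟨u, Or.inl hu⟩ ⟨q, Or.inl hpq⟩
        · intro v
          have := hd v
          rw [hML, dv_add, dv_Tr hM] at this
          linarith
    obtain ⟨a, b, hT⟩ := hT
    obtain ⟨n, ω, -, hω⟩ := traj_of_tr hT
    refine ⟨n, ?_, ω, fun v w => by rw [hω]⟩
    rcases Nat.eq_zero_or_pos n with rfl | h
    · obtain ⟨x, y, hxy⟩ := hN
      rw [hω, transCount_zero] at hxy
      exact absurd rfl hxy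
    · exact h
end

section
/- Let (V, 𝒜) be a finite directed graph and ω a trajectory of the graph. Then there exist an elementary (cycle-free) subtrajectory ω_e, possibly empty, and nonnegative integers λ(c) indexed by the cycles c of the graph, such that N(ω) = N(ω_e) + Σ_c λ(c) N(c); all the matrices N(ω_e) and N(c) have entries in {0,1}, and if ω_e is nonempty it has the same initial and final vertex as ω. -/
def cntN {V : Type*} [DecidableEq V] (f : ℕ → V) (n : ℕ) (v w : V) : ℕ :=
  ∑ k ∈ Finset.range n, if f k = v ∧ f (k + 1) = w then 1 else 0

theorem transCount_eq_cntN {V : Type*} [DecidableEq V] {n : ℕ} (f : ℕ → V) (v w : V) :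
    transCount (fun k : Fin (n + 1) => f k) v w = cntN f n v w := by
  unfold transCount cntN
  rw [Finset.card_filter, Finset.sum_range]
  simp

theorem cntN_le_one {V : Type*} [DecidableEq V] (f : ℕ → V) (n : ℕ) (v w : V)
    (h : ∀ a b, a < b → b < n → f a ≠ f b) : cntN f n v w ≤ 1 := by
  unfold cntN
  rw [← Finset.card_filter, Finset.card_le_one]
  intro a ha b hb
  simp only [Finset.mem_filter, Finset.mem_range] at ha hb
  rcases lt_trichotomy a b with hab | hab | hab
  · exact absurd (ha.2.1.trans hb.2.1.symm) (h a b hab hb.1)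
  · exact hab
  · exact absurd (hb.2.1.trans ha.2.1.symm) (h b a hab ha.1)

theorem cntN_add {V : Type*} [DecidableEq V] (f : ℕ → V) (a b : ℕ) (v w : V) :
    cntN f (a + b) v w = cntN f a v w + cntN (fun k => f (a + k)) b v w := by
  unfold cntN
  rw [Finset.sum_range_add]
  simp [add_assoc]

theorem cntN_congr {V : Type*} [DecidableEq V] (f g : ℕ → V) (a : ℕ) (v w : V)
    (h : ∀ k ≤ a, f k = g k) : cntN f a v w = cntN g a v w := by
  unfold cntN
  refine Finset.sum_congr rfl fun k hk => ?_
  have := Finset.mem_range.1 hk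
  rw [h k (by omega), h (k + 1) (by omega)]

theorem decompN {V : Type*} [DecidableEq V] (E : V → V → Prop) (n : ℕ) :
    ∀ f : ℕ → V, (∀ k < n, E (f k) (f (k + 1))) →
    ∃ L : List (ℕ × (ℕ → V)),
      (∀ p ∈ L, 1 ≤ p.1 ∧ (∀ k < p.1, E (p.2 k) (p.2 (k + 1))) ∧ p.2 p.1 = p.2 0 ∧
        ∀ a b, a < b → b < p.1 → p.2 a ≠ p.2 b) ∧
      ∃ (m : ℕ) (g : ℕ → V), (∀ k < m, E (g k) (g (k + 1))) ∧
        (∀ a b, a < b → b ≤ m → g a ≠ g b) ∧ g 0 = f 0 ∧ g m = f n ∧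
        ∀ v w, cntN f n v w = cntN g m v w + (L.map (fun p => cntN p.2 p.1 v w)).sum := by
  classical
  induction n using Nat.strong_induction_on with
  | _ n ih =>
  intro f hf
  by_cases hinj : ∀ a b, a < b → b ≤ n → f a ≠ f b
  · exact ⟨[], by simp, n, f, hf, hinj, rfl, rfl, by simp⟩
  have hex : ∃ d, 0 < d ∧ ∃ i, i + d ≤ n ∧ f i = f (i + d) := by
    push Not at hinj
    obtain ⟨a, b, hab, hb, h⟩ := hinj
    exact ⟨b - a, by omega, a, by omega, by rw [h]; congr 1; omega⟩
  obtain ⟨hd, i, hi, hfi⟩ := Nat.find_spec hex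
  have hmin := fun m (hm : m < Nat.find hex) => Nat.find_min hex hm
  generalize Nat.find hex = d at hd hi hfi hmin
  obtain ⟨t, rfl⟩ := Nat.exists_eq_add_of_le hi
  let f' : ℕ → V := fun k => if k < i then f k else f (k + d)
  have hf'1 : ∀ k ≤ i, f' k = f k := by
    intro k hk
    by_cases h : k < i
    · simp [f', h]
    · have : k = i := by omega
      subst this
      simp [f', hfi]
  have hf'2 : ∀ k, i ≤ k → f' k = f (k + d) := by
    intro k hk
    simp [f', not_lt.2 hk]
  obtain ⟨L, hL, m, g, hg, hginj, hg0, hgm, hc⟩ := ih (i + t) (by omega) f' (by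
    intro k hk
    by_cases h : k < i
    · rw [hf'1 k h.le, hf'1 (k + 1) h]
      exact hf k (by omega)
    · rw [hf'2 k (by omega), hf'2 (k + 1) (by omega)]
      have := hf (k + d) (by omega)
      rwa [show k + 1 + d = k + d + 1 by omega])
  refine ⟨(d, fun k => f (i + k)) :: L, ?_, m, g, hg, hginj, ?_, ?_, ?_⟩
  · intro p hp
    rcases List.mem_cons.1 hp with rfl | hp
    · refine ⟨hd, fun k hk => hf (i + k) (by omega), by simpa using hfi.symm, ?_⟩
      intro a b hab hb heq
      refine hmin (b - a) (by simp at hb; omega) ⟨by omega, i + a, by simp at hb; omega, ?_⟩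
      simp only at heq
      rw [heq]; congr 1; omega
    · exact hL p hp
  · rw [hg0, hf'1 0 (by omega)]
  · rw [hgm, hf'2 _ (by omega)]; congr 1; omega
  · intro v w
    have h1 := hc v w
    rw [cntN_add, cntN_congr f' f i v w hf'1,
      cntN_congr (fun k => f' (i + k)) (fun k => f (i + d + k)) t v w
        (fun k _ => by
          rw [hf'2 _ (by omega)]; congr 1; omega)] at h1
    rw [cntN_add, cntN_add]
    simp only [List.map_cons, List.sum_cons]
    omega

/-- Every trajectory `ω` of a directed graph decomposes as an elementary
(cycle-free) subtrajectory `ω_e` (possibly empty) plus a nonnegative integer combination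
of cycles: `N(ω) = N(ω_e) + ∑_c λ(c) N(c)`; the matrices `N(ω_e)` and `N(c)` are boolean,
and if `ω_e` is nonempty it has the same initial and final vertex as `ω`. -/
theorem stmt7 {V : Type*} [Fintype V] [DecidableEq V] (E : V → V → Prop)
    (n : ℕ) (hn : 1 ≤ n) (ω : Fin (n + 1) → V)
    (hω : ∀ k : Fin n, E (ω k.castSucc) (ω k.succ)) :
    ∃ (r : ℕ) (m : Fin r → ℕ) (c : ∀ i, Fin (m i + 1) → V) (lam : Fin r → ℕ),
      (∀ i, 1 ≤ m i) ∧
      (∀ i, ∀ k : Fin (m i), E (c i k.castSucc) (c i k.succ)) ∧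
      (∀ i, c i (Fin.last (m i)) = c i 0) ∧
      (∀ i, ∀ j j' : Fin (m i), c i j.castSucc = c i j'.castSucc → j = j') ∧
      (∀ i v w, transCount (c i) v w ≤ 1) ∧
      ((∀ v w, transCount ω v w = ∑ i, lam i * transCount (c i) v w)
        ∨ ∃ (ke : ℕ) (ωe : Fin (ke + 1) → V),
            (∀ k : Fin ke, E (ωe k.castSucc) (ωe k.succ)) ∧
            Function.Injective ωe ∧
            ωe 0 = ω 0 ∧ ωe (Fin.last ke) = ω (Fin.last n) ∧
            (∀ v w, transCount ωe v w ≤ 1) ∧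
            ∀ v w, transCount ω v w = transCount ωe v w + ∑ i, lam i * transCount (c i) v w) := by
  classical
  let f : ℕ → V := fun k => ω (Fin.ofNat (n + 1) k)
  have hfω : ω = fun k : Fin (n + 1) => f k := by
    funext k
    simp [f]
  have hf : ∀ k < n, E (f k) (f (k + 1)) := by
    intro k hk
    have := hω ⟨k, hk⟩
    rw [hfω] at this
    simpa using this
  obtain ⟨L, hL, m, g, hg, hginj, hg0, hgm, hc⟩ := decompN E n f hf
  have hL' : ∀ i : Fin L.length, _ := fun i => hL (L.get i) (List.get_mem L i)
  refine ⟨L.length, fun i => (L.get i).1, fun i k => (L.get i).2 k, fun _ => 1,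
    fun i => (hL' i).1, fun i k => by simpa using (hL' i).2.1 k k.2,
    fun i => by simpa using (hL' i).2.2.1, ?_, ?_, Or.inr ⟨m, fun k => g k, ?_, ?_, ?_, ?_, ?_, ?_⟩⟩
  · intro i j j' h
    simp only [Fin.val_castSucc] at h
    have := (hL' i).2.2.2
    rcases lt_trichotomy j j' with hab | hab | hab
    · exact absurd h (this j j' hab j'.2)
    · exact hab
    · exact absurd h.symm (this j' j hab j.2)
  · intro i v w
    rw [transCount_eq_cntN]
    exact cntN_le_one _ _ _ _ (hL' i).2.2.2
  · intro k
    simpa using hg k k.2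
  · intro j j' h
    simp only at h
    rcases lt_trichotomy j j' with hab | hab | hab
    · exact absurd h (hginj j j' hab (by omega))
    · exact hab
    · exact absurd h.symm (hginj j' j hab (by omega))
  · rw [hfω]; simpa using hg0
  · rw [hfω]; simpa using hgm
  · intro v w
    rw [transCount_eq_cntN]
    exact cntN_le_one _ _ _ _ fun a b hab hb => hginj a b hab hb.le
  · intro v w
    rw [hfω, transCount_eq_cntN, transCount_eq_cntN, hc v w]
    congr 1
    simp only [one_mul, transCount_eq_cntN]
    rw [← List.sum_ofFn]
    congr 1
    apply List.ext_get
    · simp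
    · intro k h1 h2
      simp
end

section
/- Let P and Q be two irreducible transition matrices on a finite state space V with the same support (P_{v→w} > 0 if and only if Q_{v→w} > 0), and let π_P and π_Q be their unique stationary probabilities. Suppose that for every cycle c of the common support graph (including loops v→v) the transition monomials agree: ∏_{v,w} P_{v→w}^{N_{v→w}(c)} = ∏_{v,w} Q_{v→w}^{N_{v→w}(c)}. Then the stationary two-step joint distributions coincide: π_P(v) P_{v→w} = π_Q(v) Q_{v→w} for all v, w ∈ V. -/
theorem aux_monomial {V : Type*} [Fintype V] [DecidableEq V] (P : V → V → ℝ) {m : ℕ}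
    (c : Fin (m + 1) → V) :
    ∏ v, ∏ w, P v w ^ transCount c v w = ∏ k : Fin m, P (c k.castSucc) (c k.succ) := by
  have h : ∀ v w, P v w ^ transCount c v w =
      ∏ k : Fin m, if c k.castSucc = v then (if c k.succ = w then P v w else 1) else 1 := by
    intro v w
    rw [transCount, ← Finset.prod_const, Finset.prod_filter]
    refine Finset.prod_congr rfl fun k _ => ?_
    by_cases h1 : c k.castSucc = v <;> by_cases h2 : c k.succ = w <;> simp [h1, h2]
  simp_rw [h]
  have h2 : ∀ v, (∏ w, ∏ k : Fin m, if c k.castSucc = v then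
      (if c k.succ = w then P v w else 1) else 1) =
      ∏ k : Fin m, if c k.castSucc = v then P v (c k.succ) else 1 := by
    intro v
    rw [Finset.prod_comm]
    refine Finset.prod_congr rfl fun k _ => ?_
    by_cases h1 : c k.castSucc = v <;> simp [h1]
  simp_rw [h2]
  rw [Finset.prod_comm]
  refine Finset.prod_congr rfl fun k _ => ?_
  simp

/-- closed walks have zero sum as soon as elementary ones do -/
theorem aux_closed {V : Type*} (E : V → V → Prop) (f : V → V → ℝ)
    (hel : ∀ (m : ℕ), 1 ≤ m → ∀ c : ℕ → V, (∀ k < m, E (c k) (c (k+1))) → c m = c 0 →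
      (∀ i < m, ∀ j < m, c i = c j → i = j) → ∑ k ∈ Finset.range m, f (c k) (c (k+1)) = 0) :
    ∀ (n : ℕ) (c : ℕ → V), (∀ k < n, E (c k) (c (k+1))) → c n = c 0 →
      ∑ k ∈ Finset.range n, f (c k) (c (k+1)) = 0 := by
  intro n
  induction n using Nat.strong_induction_on with
  | _ n ih =>
  intro c hE hc
  rcases Nat.eq_zero_or_pos n with rfl | hn
  · simp
  by_cases hinj : ∀ i < n, ∀ j < n, c i = c j → i = j
  · exact hel n hn c hE hc hinj
  have : ∃ i j, i < j ∧ j < n ∧ c i = c j := by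
    push Not at hinj
    obtain ⟨i, hi, j, hj, h, hne⟩ := hinj
    rcases lt_or_gt_of_ne hne with h' | h'
    · exact ⟨i, j, h', hj, h⟩
    · exact ⟨j, i, h', hi, h.symm⟩
  obtain ⟨i, j, hij, hjn, hcij⟩ := this
  obtain ⟨d, rfl⟩ := Nat.exists_eq_add_of_lt hij
  obtain ⟨e, rfl⟩ := Nat.exists_eq_add_of_lt hjn
  -- inner
  have h1 := ih (d + 1) (by omega) (fun k => c (i + k)) (fun k hk => hE (i + k) (by omega))
    (by simpa [add_assoc] using hcij.symm)
  have h2 := ih (i + (e + 1)) (by omega) (fun k => if k ≤ i then c k else c (k + (d + 1)))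
    (by
      intro k hk
      rcases lt_trichotomy k i with h | h | h
      · simp only [h.le, if_true, Nat.succ_le_of_lt h]
        exact hE k (by omega)
      · subst h
        simp only [le_refl, if_true, show ¬ (k + 1 ≤ k) by omega, if_false]
        rw [hcij]
        have := hE (k + d + 1) (by omega)
        convert this using 2; omega
      · simp only [show ¬ (k ≤ i) by omega, show ¬ (k + 1 ≤ i) by omega, if_false]
        have := hE (k + (d + 1)) (by omega)
        convert this using 2; omega)
    (by
      simp only [show ¬ (i + (e + 1) ≤ i) by omega, if_false, Nat.zero_le, if_true]
      rw [← hc]; congr 1; omega)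
  have hlen : i + d + 1 + e + 1 = (i + (d + 1)) + (e + 1) := by omega
  rw [hlen, Finset.sum_range_add _ (i + (d+1)), Finset.sum_range_add _ i]
  rw [Finset.sum_range_add _ i] at h2
  have h3 : ∑ x ∈ Finset.range i, f (if x ≤ i then c x else c (x + (d + 1)))
      (if x + 1 ≤ i then c (x+1) else c (x + 1 + (d + 1))) =
      ∑ x ∈ Finset.range i, f (c x) (c (x+1)) := by
    refine Finset.sum_congr rfl fun x hx => ?_
    have := Finset.mem_range.1 hx
    rw [if_pos (by omega), if_pos (by omega)]
  have h4 : ∑ x ∈ Finset.range (e+1), f (if i + x ≤ i then c (i + x) else c (i + x + (d + 1)))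
      (if i + x + 1 ≤ i then c (i + x+1) else c (i + x + 1 + (d + 1))) =
      ∑ x ∈ Finset.range (e+1), f (c (i + (d+1) + x)) (c (i + (d+1) + x+1)) := by
    refine Finset.sum_congr rfl fun x hx => ?_
    have e1 : i + x + 1 + (d+1) = i + (d+1) + x + 1 := by omega
    rw [if_neg (show ¬ (i + x + 1 ≤ i) by omega), e1]
    rcases Nat.eq_zero_or_pos x with rfl | hx0
    · simp only [add_zero, le_refl, if_true, hcij]
      rfl
    · rw [if_neg (by omega)]
      congr 2; omega
  rw [h3, h4] at h2
  simp only [← add_assoc] at h1 h2 ⊢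
  linarith

inductive AuxR {V : Type*} (E : V → V → Prop) (f : V → V → ℝ) (a : V) : V → ℝ → Prop
  | refl : AuxR E f a a 0
  | tail {b c : V} {x : ℝ} : AuxR E f a b x → E b c → AuxR E f a c (x + f b c)

theorem AuxR.trans {V : Type*} {E : V → V → Prop} {f : V → V → ℝ} {a b c : V} {x y : ℝ}
    (h : AuxR E f a b x) (h' : AuxR E f b c y) : AuxR E f a c (x + y) := by
  induction h' with
  | refl => simpa using h
  | tail _ e ih => rw [← add_assoc]; exact ih.tail e

theorem AuxR.ex {V : Type*} {E : V → V → Prop} (f : V → V → ℝ) {a b : V}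
    (h : Relation.ReflTransGen E a b) : ∃ x, AuxR E f a b x := by
  induction h with
  | refl => exact ⟨0, .refl⟩
  | tail _ e ih => obtain ⟨x, hx⟩ := ih; exact ⟨_, hx.tail e⟩

theorem AuxR.walk {V : Type*} {E : V → V → Prop} {f : V → V → ℝ} {a b : V} {x : ℝ}
    (h : AuxR E f a b x) : ∃ (n : ℕ) (c : ℕ → V), (∀ k < n, E (c k) (c (k+1))) ∧ c 0 = a ∧
      c n = b ∧ ∑ k ∈ Finset.range n, f (c k) (c (k+1)) = x := by
  induction h with
  | refl => exact ⟨0, fun _ => a, by simp, rfl, rfl, by simp⟩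
  | @tail b d x _ e ih =>
    obtain ⟨n, c, hE, h0, hn, hs⟩ := ih
    refine ⟨n + 1, fun k => if k ≤ n then c k else d, ?_, by simpa using h0, by simp, ?_⟩
    · intro k hk
      rcases Nat.lt_succ_iff_lt_or_eq.1 hk with h | rfl
      · simp only [h.le, if_true, Nat.succ_le_of_lt h]; exact hE k h
      · simpa [hn] using e
    · rw [Finset.sum_range_succ]
      congr 1
      · rw [← hs]
        refine Finset.sum_congr rfl fun k hk => ?_
        have := Finset.mem_range.1 hk
        beta_reduce
        rw [if_pos (by omega), if_pos (by omega)]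
      · simp [hn]

theorem aux_potential {V : Type*} [Nonempty V] (E : V → V → Prop) (f : V → V → ℝ)
    (hirr : ∀ v w, Relation.ReflTransGen E v w)
    (hel : ∀ (m : ℕ), 1 ≤ m → ∀ c : ℕ → V, (∀ k < m, E (c k) (c (k+1))) → c m = c 0 →
      (∀ i < m, ∀ j < m, c i = c j → i = j) → ∑ k ∈ Finset.range m, f (c k) (c (k+1)) = 0) :
    ∃ g : V → ℝ, ∀ v w, E v w → g w = g v + f v w := by
  obtain ⟨v0⟩ := ‹Nonempty V›
  choose g hg using fun v => AuxR.ex f (hirr v0 v)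
  have hcl : ∀ a x, AuxR E f a a x → x = 0 := by
    intro a x h
    obtain ⟨n, c, hE, h0, hn, hs⟩ := h.walk
    rw [← hs]; exact aux_closed E f hel n c hE (hn.trans h0.symm)
  refine ⟨g, fun v w e => ?_⟩
  obtain ⟨y, hy⟩ := AuxR.ex f (hirr w v0)
  have h1 := hcl _ _ ((hg w).trans hy)
  have h2 := hcl _ _ (((hg v).tail e).trans hy)
  linarith

theorem aux_harmonic {V : Type*} [Fintype V] [Nonempty V] (Q : V → V → ℝ) (G : V → ℝ)
    (hQ0 : ∀ v w, 0 ≤ Q v w) (hQ1 : ∀ v, ∑ w, Q v w = 1)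
    (hirr : ∀ v w : V, Relation.ReflTransGen (fun a b => 0 < Q a b) v w)
    (hG : ∀ v, ∑ w, Q v w * G w = G v) : ∃ a, ∀ v, G v = a := by
  obtain ⟨v0, h0⟩ := Finite.exists_max G
  refine ⟨G v0, fun v => ?_⟩
  induction hirr v0 v with
  | refl => rfl
  | @tail b c _ e ih =>
    have hs : ∑ w, Q b w * (G v0 - G w) = 0 := by
      simp_rw [mul_sub]
      rw [Finset.sum_sub_distrib, hG, ← Finset.sum_mul, hQ1, ih]; ring
    rw [Finset.sum_eq_zero_iff_of_nonneg
      (fun w _ => mul_nonneg (hQ0 b w) (sub_nonneg.2 (h0 w)))] at hs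
    have := hs c (Finset.mem_univ _)
    rcases mul_eq_zero.1 this with h | h
    · exact absurd h e.ne'
    · linarith

theorem aux_pos {V : Type*} [Fintype V] (Q : V → V → ℝ) (e : V → ℝ)
    (hQ0 : ∀ v w, 0 ≤ Q v w)
    (hirr : ∀ v w : V, Relation.ReflTransGen (fun a b => 0 < Q a b) v w)
    (he0 : ∀ v, 0 ≤ e v) (he : ∀ w, ∑ v, e v * Q v w = e w) (v : V) (hv : 0 < e v) :
    ∀ w, 0 < e w := by
  intro w
  induction hirr v w with
  | refl => exact hv
  | @tail b c _ hbc ih =>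
    rw [← he c]
    exact Finset.sum_pos' (fun i _ => mul_nonneg (he0 i) (hQ0 i c))
      ⟨b, Finset.mem_univ _, mul_pos ih hbc⟩

theorem aux_unique {V : Type*} [Fintype V] [Nonempty V] (Q : V → V → ℝ) (p q : V → ℝ)
    (hQ0 : ∀ v w, 0 ≤ Q v w)
    (hirr : ∀ v w : V, Relation.ReflTransGen (fun a b => 0 < Q a b) v w)
    (hp1 : ∑ v, p v = 1) (hp : ∀ w, ∑ v, p v * Q v w = p w)
    (hq0 : ∀ v, 0 ≤ q v) (hq1 : ∑ v, q v = 1) (hq : ∀ w, ∑ v, q v * Q v w = q w) :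
    ∀ v, p v = q v := by
  have hqpos : ∀ v, 0 < q v := by
    obtain ⟨v, -, hv⟩ := Finset.exists_ne_zero_of_sum_ne_zero (hq1.trans_ne one_ne_zero)
    exact aux_pos Q q hQ0 hirr hq0 hq v (lt_of_le_of_ne (hq0 v) hv.symm)
  obtain ⟨v0, h0⟩ := Finite.exists_min (fun v => p v / q v)
  set r := p v0 / q v0 with hr
  have hz : ∀ v, p v - r * q v = 0 := by
    by_contra hne
    push Not at hne
    obtain ⟨v, hv⟩ := hne
    have hnn : ∀ v, 0 ≤ p v - r * q v := fun v => by
      have := (le_div_iff₀ (hqpos v)).1 (h0 v)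
      linarith
    have := aux_pos Q (fun v => p v - r * q v) hQ0 hirr hnn (by
      intro w
      simp_rw [sub_mul, mul_assoc]
      rw [Finset.sum_sub_distrib, ← Finset.mul_sum, hp, hq]) v (lt_of_le_of_ne (hnn v) hv.symm) v0
    simp only [hr] at this
    rw [div_mul_cancel₀ _ (hqpos v0).ne'] at this
    linarith
  have h1 : r = 1 := by
    have : ∑ v, (p v - r * q v) = 0 := Finset.sum_eq_zero fun v _ => hz v
    rw [Finset.sum_sub_distrib, ← Finset.mul_sum, hp1, hq1] at this
    linarith
  intro v
  have := hz v
  rw [h1] at this; linarith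

/-- If two irreducible transition matrices with the same support have equal
transition monomials on every cycle of the support graph, then their stationary two-step
joint distributions coincide. -/
theorem stmt8 {V : Type*} [Fintype V] [DecidableEq V] [Nonempty V]
    (P Q : V → V → ℝ) (piP piQ : V → ℝ)
    (hP0 : ∀ v w, 0 ≤ P v w) (hP1 : ∀ v, ∑ w, P v w = 1)
    (hQ0 : ∀ v w, 0 ≤ Q v w) (hQ1 : ∀ v, ∑ w, Q v w = 1)
    (hsupp : ∀ v w, 0 < P v w ↔ 0 < Q v w)
    (hirr : ∀ v w : V, Relation.ReflTransGen (fun a b => 0 < P a b) v w)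
    (hpiP0 : ∀ v, 0 ≤ piP v) (hpiP1 : ∑ v, piP v = 1)
    (hpiPstat : ∀ w, ∑ v, piP v * P v w = piP w)
    (hpiQ0 : ∀ v, 0 ≤ piQ v) (hpiQ1 : ∑ v, piQ v = 1)
    (hpiQstat : ∀ w, ∑ v, piQ v * Q v w = piQ w)
    (hcyc : ∀ (m : ℕ), 1 ≤ m → ∀ c : Fin (m + 1) → V,
      (∀ k : Fin m, 0 < P (c k.castSucc) (c k.succ)) →
      c (Fin.last m) = c 0 →
      (∀ j j' : Fin m, c j.castSucc = c j'.castSucc → j = j') →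
      ∏ v, ∏ w, P v w ^ transCount c v w = ∏ v, ∏ w, Q v w ^ transCount c v w) :
    ∀ v w, piP v * P v w = piQ v * Q v w := by
  have hQ_irr : ∀ v w : V, Relation.ReflTransGen (fun a b => 0 < Q a b) v w := fun v w =>
    Relation.ReflTransGen.mono (fun a b h => (hsupp a b).1 h) _ _ (hirr v w)
  obtain ⟨g, hg⟩ := aux_potential (fun a b => 0 < P a b)
    (fun a b => Real.log (P a b) - Real.log (Q a b)) hirr (by
      intro m hm c hE hc hinj
      have h := hcyc m hm (fun k => c k) (fun k => by simpa using hE k k.2) (by simpa using hc)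
        (fun j j' h => Fin.ext (hinj j j.2 j' j'.2 (by simpa using h)))
      rw [aux_monomial, aux_monomial] at h
      have h' := congrArg Real.log h
      rw [Real.log_prod (fun k _ => by simpa using (hE k k.2).ne'),
        Real.log_prod (fun k _ => by simpa using ((hsupp _ _).1 (hE k k.2)).ne')] at h'
      rw [Finset.sum_range, Finset.sum_sub_distrib, sub_eq_zero]
      simpa using h')
  have hPQ : ∀ v w, P v w * Real.exp (g v) = Q v w * Real.exp (g w) := by
    intro v w
    by_cases h : 0 < P v w
    · have hq := (hsupp v w).1 h
      rw [hg v w h, Real.exp_add, Real.exp_sub, Real.exp_log h, Real.exp_log hq]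
      field_simp
    · have hq : ¬ 0 < Q v w := fun hq => h ((hsupp v w).2 hq)
      rw [le_antisymm (not_lt.1 h) (hP0 v w), le_antisymm (not_lt.1 hq) (hQ0 v w)]
      simp
  obtain ⟨a, ha⟩ := aux_harmonic Q (fun v => Real.exp (g v)) hQ0 hQ1 hQ_irr (fun v => by
    simp_rw [← hPQ v]
    rw [← Finset.sum_mul, hP1, one_mul])
  have hEq : ∀ v w, P v w = Q v w := by
    intro v w
    have h := hPQ v w
    have h1 := ha v
    have h2 := ha w
    beta_reduce at h1 h2
    rw [h2, ← h1] at h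
    exact mul_right_cancel₀ (Real.exp_pos _).ne' h
  intro v w
  rw [hEq, aux_unique Q piP piQ hQ0 hQ_irr hpiP1 (fun w => by simpa only [hEq] using hpiPstat w)
    hpiQ0 hpiQ1 hpiQstat v]
end

section
/- Let P be an irreducible transition matrix on a finite state space V with symmetric support (P_{v→w} > 0 if and only if P_{w→v} > 0), let π be its stationary probability, and for n ≥ 1 let ℙ_n be the law of the stationary chain on trajectories of length n, ℙ_n(v_0⋯v_n) = π(v_0) ∏_{k=1}^n P_{v_{k-1}→v_k}, and ℙ_n^r the law of the reversed trajectories, ℙ_n^r(ω) = ℙ_n(rω) where rω = v_n v_{n-1}⋯v_0. Then the Kullback–Leibler divergence satisfies D(ℙ_n ‖ ℙ_n^r) = n · Σ_{v,w : P_{v→w}>0} π(v) P_{v→w} · log( (π(v) P_{v→w}) / (π(w) P_{w→v}) ). -/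
lemma snoc_sum_aux {V : Type*} [Fintype V] [DecidableEq V] (n : ℕ) (F : (Fin (n + 1) → V) → ℝ) :
    ∑ ω, F ω = ∑ ω : Fin n → V, ∑ w, F (Fin.snoc (α := fun _ => V) ω w) := by
  rw [← (Fin.snocEquiv (fun _ : Fin (n + 1) => V)).sum_comp, Fintype.sum_prod_type,
    Finset.sum_comm]
  rfl

lemma prod_snoc_aux {V : Type*} (P : V → V → ℝ) (n : ℕ) (ω : Fin (n + 1) → V) (w : V) :
    (∏ k : Fin (n + 1), P ((Fin.snoc ω w : Fin (n + 2) → V) k.castSucc)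
      ((Fin.snoc ω w : Fin (n + 2) → V) k.succ)) =
    (∏ k : Fin n, P (ω k.castSucc) (ω k.succ)) * P (ω (Fin.last n)) w := by
  rw [Fin.prod_univ_castSucc]
  simp only [Fin.succ_last, Fin.snoc_last, Fin.snoc_castSucc, Fin.succ_castSucc]

lemma sum_snoc_aux {V : Type*} (P : V → V → ℝ) (n : ℕ) (ω : Fin (n + 1) → V) (w : V) :
    (∑ k : Fin (n + 1), P ((Fin.snoc ω w : Fin (n + 2) → V) k.castSucc)
      ((Fin.snoc ω w : Fin (n + 2) → V) k.succ)) =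
    (∑ k : Fin n, P (ω k.castSucc) (ω k.succ)) + P (ω (Fin.last n)) w := by
  rw [Fin.sum_univ_castSucc]
  simp only [Fin.succ_last, Fin.snoc_last, Fin.snoc_castSucc, Fin.succ_castSucc]

lemma snoc_zero_aux {V : Type*} (n : ℕ) (ω : Fin (n + 1) → V) (w : V) :
    (Fin.snoc ω w : Fin (n + 2) → V) 0 = ω 0 := by
  rw [← Fin.castSucc_zero, Fin.snoc_castSucc (α := fun _ => V)]

lemma last_aux {V : Type*} [Fintype V] [DecidableEq V]
    (P : V → V → ℝ) (pi : V → ℝ)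
    (hstat : ∀ w, ∑ v, pi v * P v w = pi w) (n : ℕ) : ∀ f : V → ℝ,
    ∑ ω : Fin (n + 1) → V, (pi (ω 0) * ∏ k : Fin n, P (ω k.castSucc) (ω k.succ)) *
      f (ω (Fin.last n)) = ∑ v, pi v * f v := by
  induction n with
  | zero =>
    intro f
    rw [← (Equiv.funUnique (Fin 1) V).symm.sum_comp]
    simp
  | succ n ih =>
    intro f
    rw [snoc_sum_aux]
    simp only [prod_snoc_aux, snoc_zero_aux, Fin.snoc_last]
    have h := ih (fun v => ∑ w, P v w * f w)
    simp only [Finset.mul_sum] at h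
    simp only [← mul_assoc] at h ⊢
    rw [h, Finset.sum_comm]
    simp only [← Finset.sum_mul, hstat]

lemma add_aux {V : Type*} [Fintype V] [DecidableEq V]
    (P : V → V → ℝ) (pi : V → ℝ) (hP1 : ∀ v, ∑ w, P v w = 1)
    (hstat : ∀ w, ∑ v, pi v * P v w = pi w) (g : V → V → ℝ) (n : ℕ) :
    ∑ ω : Fin (n + 1) → V, (pi (ω 0) * ∏ k : Fin n, P (ω k.castSucc) (ω k.succ)) *
      (∑ k : Fin n, g (ω k.castSucc) (ω k.succ)) = n * ∑ v, ∑ w, pi v * P v w * g v w := by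
  induction n with
  | zero => simp
  | succ n ih =>
    rw [snoc_sum_aux]
    simp only [prod_snoc_aux, snoc_zero_aux, sum_snoc_aux]
    have h := last_aux P pi hstat n (fun v => ∑ w, P v w * g v w)
    have e : ∀ ω : Fin (n + 1) → V, ∑ w, pi (ω 0) * ((∏ k : Fin n, P (ω k.castSucc) (ω k.succ)) *
        P (ω (Fin.last n)) w) * ((∑ k : Fin n, g (ω k.castSucc) (ω k.succ)) +
          g (ω (Fin.last n)) w) =
        (pi (ω 0) * ∏ k : Fin n, P (ω k.castSucc) (ω k.succ)) *
          (∑ k : Fin n, g (ω k.castSucc) (ω k.succ)) +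
        (pi (ω 0) * ∏ k : Fin n, P (ω k.castSucc) (ω k.succ)) *
          ∑ w, P (ω (Fin.last n)) w * g (ω (Fin.last n)) w := by
      intro ω
      generalize (∑ k : Fin n, g (ω k.castSucc) (ω k.succ)) = S
      generalize (∏ k : Fin n, P (ω k.castSucc) (ω k.succ)) = Q
      rw [← mul_one (pi (ω 0) * Q * S), ← hP1 (ω (Fin.last n)),
        Finset.mul_sum, Finset.mul_sum, ← Finset.sum_add_distrib]
      exact Finset.sum_congr rfl fun w _ => by ring
    simp only [e, Finset.sum_add_distrib]
    rw [ih, h]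
    simp only [Finset.mul_sum, ← mul_assoc]
    push_cast
    simp only [add_mul, one_mul, Finset.sum_add_distrib]

lemma pos_aux {V : Type*} [Fintype V] [DecidableEq V]
    (P : V → V → ℝ) (pi : V → ℝ) (hP0 : ∀ v w, 0 ≤ P v w)
    (hirr : ∀ v w : V, Relation.ReflTransGen (fun a b => 0 < P a b) v w)
    (hpi0 : ∀ v, 0 ≤ pi v) (hpi1 : ∑ v, pi v = 1)
    (hstat : ∀ w, ∑ v, pi v * P v w = pi w) (w : V) : 0 < pi w := by
  have : ∃ v, 0 < pi v := by
    by_contra! h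
    have := Finset.sum_nonpos (s := Finset.univ) fun v _ => h v
    linarith
  obtain ⟨v, hv⟩ := this
  induction hirr v w with
  | refl => exact hv
  | tail _ hbc ih =>
    rename_i b c _
    rw [← hstat c]
    exact Finset.sum_pos' (fun i _ => mul_nonneg (hpi0 i) (hP0 i c))
      ⟨b, Finset.mem_univ _, mul_pos ih hbc⟩

/-- For a stationary irreducible Markov chain with symmetric support, the
Kullback–Leibler divergence between the law of the trajectory `(X_0,…,X_n)` and the law of
the reversed trajectory equals
`n · ∑_{v,w} π(v) P_{v→w} log((π(v)P_{v→w})/(π(w)P_{w→v}))`. -/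
theorem stmt9 {V : Type*} [Fintype V] [DecidableEq V]
    (P : V → V → ℝ) (pi : V → ℝ)
    (hP0 : ∀ v w, 0 ≤ P v w) (hP1 : ∀ v, ∑ w, P v w = 1)
    (hsym : ∀ v w, 0 < P v w ↔ 0 < P w v)
    (hirr : ∀ v w : V, Relation.ReflTransGen (fun a b => 0 < P a b) v w)
    (hpi0 : ∀ v, 0 ≤ pi v) (hpi1 : ∑ v, pi v = 1)
    (hstat : ∀ w, ∑ v, pi v * P v w = pi w)
    (n : ℕ) (hn : 1 ≤ n) :
    (∑ ω : Fin (n + 1) → V,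
        (pi (ω 0) * ∏ k : Fin n, P (ω k.castSucc) (ω k.succ)) *
          Real.log ((pi (ω 0) * ∏ k : Fin n, P (ω k.castSucc) (ω k.succ)) /
            (pi ((fun j : Fin (n + 1) => ω j.rev) 0) *
              ∏ k : Fin n, P ((fun j : Fin (n + 1) => ω j.rev) k.castSucc)
                ((fun j : Fin (n + 1) => ω j.rev) k.succ))))
      = (n : ℝ) * ∑ v, ∑ w,
          pi v * P v w * Real.log ((pi v * P v w) / (pi w * P w v)) := by
  have hpos := pos_aux P pi hP0 hirr hpi0 hpi1 hstat
  rw [← add_aux P pi hP1 hstat (fun v w => Real.log ((pi v * P v w) / (pi w * P w v))) n]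
  refine Finset.sum_congr rfl fun ω _ => ?_
  by_cases hz : ∀ k : Fin n, 0 < P (ω k.castSucc) (ω k.succ)
  · congr 1
    have hz' : ∀ k : Fin n, 0 < P (ω k.succ) (ω k.castSucc) := fun k => (hsym _ _).1 (hz k)
    rw [← Real.log_prod (fun k _ => (div_pos (mul_pos (hpos _) (hz k))
      (mul_pos (hpos _) (hz' k))).ne')]
    congr 1
    have hrev : (∏ k : Fin n, P (ω (Fin.rev k.castSucc)) (ω (Fin.rev k.succ))) =
        ∏ k : Fin n, P (ω k.succ) (ω k.castSucc) := by
      rw [← Equiv.prod_comp Fin.revPerm]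
      simp [Fin.rev_castSucc, Fin.rev_succ]
    simp only [hrev, Fin.rev_zero, Finset.prod_div_distrib, Finset.prod_mul_distrib]
    have h1 := Fin.prod_univ_succ (fun k => pi (ω k))
    rw [Fin.prod_univ_castSucc] at h1
    have p1 : 0 < ∏ k : Fin n, P (ω k.succ) (ω k.castSucc) := Finset.prod_pos fun k _ => hz' k
    have p2 : 0 < ∏ k : Fin n, pi (ω k.succ) := Finset.prod_pos fun k _ => hpos _
    rw [div_eq_div_iff (mul_pos (hpos _) p1).ne' (mul_pos p2 p1).ne']
    linear_combination (-(∏ k : Fin n, P (ω k.castSucc) (ω k.succ)) *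
      ∏ k : Fin n, P (ω k.succ) (ω k.castSucc)) * h1
  · push Not at hz
    obtain ⟨k, hk⟩ := hz
    have : (∏ k : Fin n, P (ω k.castSucc) (ω k.succ)) = 0 :=
      Finset.prod_eq_zero (Finset.mem_univ k) (le_antisymm hk (hP0 _ _))
    rw [this]
    simp
end

section
/- (Kolmogorov's criterion) Let P be an irreducible transition matrix on a finite state space V whose support graph is symmetric (P_{v→w} > 0 iff P_{w→v} > 0) and connected. Then there exists a strictly positive function κ: V → ℝ_{>0} satisfying the detailed balance condition κ(v) P_{v→w} = κ(w) P_{w→v} for all v, w ∈ V if, and only if, for every closed trajectory ω of the support graph, ∏_{v,w} P_{v→w}^{N_{v→w}(ω)} = ∏_{v,w} P_{v→w}^{N_{v→w}(rω)}, where rω is the reversed closed trajectory. -/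
lemma prod_transCount {V : Type*} [Fintype V] [DecidableEq V] (P : V → V → ℝ) {n : ℕ}
    (ω : Fin (n + 1) → V) :
    ∏ v, ∏ w, P v w ^ transCount ω v w = ∏ k : Fin n, P (ω k.castSucc) (ω k.succ) := by
  have h : ∀ v w, P v w ^ transCount ω v w
      = ∏ k : Fin n, if ω k.castSucc = v then (if ω k.succ = w then P v w else 1) else 1 := by
    intro v w
    rw [transCount, ← Finset.prod_const, Finset.prod_filter]
    refine Finset.prod_congr rfl fun k _ => ?_
    by_cases h1 : ω k.castSucc = v <;> by_cases h2 : ω k.succ = w <;> simp [h1, h2]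
  simp_rw [h]
  have h2 : ∀ v, (∏ w, ∏ k : Fin n,
      if ω k.castSucc = v then (if ω k.succ = w then P v w else 1) else 1)
      = ∏ k : Fin n, if ω k.castSucc = v then P v (ω k.succ) else 1 := by
    intro v
    rw [Finset.prod_comm]
    refine Finset.prod_congr rfl fun k _ => ?_
    by_cases h1 : ω k.castSucc = v <;> simp [h1]
  simp_rw [h2]
  rw [Finset.prod_comm]
  simp

lemma prod_transCount_rev {V : Type*} [Fintype V] [DecidableEq V] (P : V → V → ℝ) {n : ℕ}
    (ω : Fin (n + 1) → V) :
    ∏ v, ∏ w, P v w ^ transCount (fun j : Fin (n + 1) => ω j.rev) v w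
      = ∏ k : Fin n, P (ω k.succ) (ω k.castSucc) := by
  rw [prod_transCount]
  rw [← Equiv.prod_comp Fin.revPerm]
  simp [Fin.rev_castSucc, Fin.rev_succ]

inductive KWalk {V : Type*} (P : V → V → ℝ) (v : V) : V → ℝ → ℝ → Prop
  | refl : KWalk P v v 1 1
  | step {w x : V} {a b : ℝ} : KWalk P v w a b → 0 < P w x → KWalk P v x (a * P w x) (b * P x w)

lemma KWalk.trans {V : Type*} {P : V → V → ℝ} {u v w : V} {a b c d : ℝ}
    (h : KWalk P u v a b) (h' : KWalk P v w c d) : KWalk P u w (a * c) (b * d) := by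
  induction h' with
  | refl => simpa using h
  | step _ hp ih => rw [← mul_assoc, ← mul_assoc]; exact ih.step hp

lemma KWalk.rev {V : Type*} {P : V → V → ℝ} (hsym : ∀ v w, 0 < P v w ↔ 0 < P w v)
    {v w : V} {a b : ℝ} (h : KWalk P v w a b) : KWalk P w v b a := by
  induction h with
  | refl => exact .refl
  | @step w x a b _ hp ih =>
    have := (KWalk.refl.step ((hsym _ _).1 hp)).trans ih
    simpa [mul_comm] using this

lemma KWalk.pos {V : Type*} {P : V → V → ℝ} (hsym : ∀ v w, 0 < P v w ↔ 0 < P w v)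
    {v w : V} {a b : ℝ} (h : KWalk P v w a b) : 0 < a ∧ 0 < b := by
  induction h with
  | refl => simp
  | step _ hp ih => exact ⟨mul_pos ih.1 hp, mul_pos ih.2 ((hsym _ _).1 hp)⟩

lemma KWalk.path {V : Type*} {P : V → V → ℝ} {v w : V} {a b : ℝ} (h : KWalk P v w a b) :
    ∃ (m : ℕ) (ω : Fin (m + 1) → V), (∀ k : Fin m, 0 < P (ω k.castSucc) (ω k.succ)) ∧
      ω 0 = v ∧ ω (Fin.last m) = w ∧ ∏ k : Fin m, P (ω k.castSucc) (ω k.succ) = a ∧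
      ∏ k : Fin m, P (ω k.succ) (ω k.castSucc) = b := by
  induction h with
  | refl => exact ⟨0, fun _ => v, by simp⟩
  | @step w x a b _ hp ih =>
    obtain ⟨m, ω, h1, h2, h3, h4, h5⟩ := ih
    have e0 : ∀ j : Fin (m + 1), (Fin.snoc ω x : Fin (m + 2) → V) j.castSucc = ω j :=
      fun j => by simp
    have el : (Fin.snoc ω x : Fin (m + 2) → V) (Fin.last (m + 1)) = x := by simp
    refine ⟨m + 1, (Fin.snoc ω x : Fin (m + 2) → V), ?_, ?_, el, ?_, ?_⟩
    · intro k
      refine Fin.lastCases ?_ (fun j => ?_) k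
      · rw [e0, Fin.succ_last, el, h3]; exact hp
      · rw [e0, Fin.succ_castSucc, e0]; exact h1 j
    · rw [← Fin.castSucc_zero, e0, h2]
    · rw [Fin.prod_univ_castSucc]
      simp only [Fin.succ_castSucc, e0, Fin.succ_last, el, h3, h4]
    · rw [Fin.prod_univ_castSucc]
      simp only [Fin.succ_castSucc, e0, Fin.succ_last, el, h3, h5]

/-- Kolmogorov's criterion: An irreducible transition matrix with symmetric
connected support satisfies detailed balance for some strictly positive `κ` iff for every
closed trajectory `ω` of the support graph the transition monomial of `ω` equals that of
the reversed trajectory `rω`. -/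
theorem stmt10 {V : Type*} [Fintype V] [DecidableEq V]
    (P : V → V → ℝ)
    (hP0 : ∀ v w, 0 ≤ P v w) (hP1 : ∀ v, ∑ w, P v w = 1)
    (hsym : ∀ v w, 0 < P v w ↔ 0 < P w v)
    (hconn : ∀ v w : V, Relation.ReflTransGen (fun a b => 0 < P a b) v w) :
    (∃ κ : V → ℝ, (∀ v, 0 < κ v) ∧ ∀ v w, κ v * P v w = κ w * P w v)
      ↔ ∀ (m : ℕ), 1 ≤ m → ∀ ω : Fin (m + 1) → V,
          (∀ k : Fin m, 0 < P (ω k.castSucc) (ω k.succ)) →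
          ω (Fin.last m) = ω 0 →
          ∏ v, ∏ w, P v w ^ transCount ω v w
            = ∏ v, ∏ w, P v w ^ transCount (fun j : Fin (m + 1) => ω j.rev) v w := by
  constructor
  · rintro ⟨κ, hκ, hb⟩ m _ ω _ hc
    rw [prod_transCount, prod_transCount_rev]
    have h1 : ∏ k : Fin m, (κ (ω k.castSucc) * P (ω k.castSucc) (ω k.succ))
        = ∏ k : Fin m, (κ (ω k.succ) * P (ω k.succ) (ω k.castSucc)) :=
      Finset.prod_congr rfl fun k _ => hb _ _
    have h2 : ∏ k : Fin m, κ (ω k.castSucc) = ∏ k : Fin m, κ (ω k.succ) := by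
      have e1 := Fin.prod_univ_succ (fun k => κ (ω k))
      have e2 := Fin.prod_univ_castSucc (fun k => κ (ω k))
      rw [e1, hc, mul_comm] at e2
      exact (mul_right_cancel₀ (hκ _).ne' e2).symm
    rw [Finset.prod_mul_distrib, Finset.prod_mul_distrib, h2] at h1
    exact mul_left_cancel₀ (Finset.prod_pos fun k _ => hκ _).ne' h1
  · intro H
    have loop : ∀ v a b, KWalk P v v a b → a = b := by
      intro v a b h
      obtain ⟨m, ω, h1, h2, h3, h4, h5⟩ := h.path
      rcases Nat.eq_zero_or_pos m with rfl | hm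
      · simp at h4 h5
        rw [← h4, ← h5]
      · have := H m hm ω h1 (h3.trans h2.symm)
        rwa [prod_transCount, prod_transCount_rev, h4, h5] at this
    rcases isEmpty_or_nonempty V with hV | ⟨⟨v0⟩⟩
    · exact ⟨fun _ => 1, fun v => hV.elim v, fun v => hV.elim v⟩
    have ex : ∀ v, ∃ a b, KWalk P v0 v a b := by
      intro v
      induction hconn v0 v with
      | refl => exact ⟨1, 1, .refl⟩
      | tail _ hp ih =>
        obtain ⟨a, b, h⟩ := ih
        exact ⟨_, _, h.step hp⟩
    choose a b hab using ex
    refine ⟨fun v => a v / b v, fun v => div_pos ((hab v).pos hsym).1 ((hab v).pos hsym).2, ?_⟩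
    intro v w
    by_cases hp : 0 < P v w
    · have := loop _ _ _ (((hab v).step hp).trans ((hab w).rev hsym))
      have hv := ((hab v).pos hsym).2.ne'
      have hw := ((hab w).pos hsym).2.ne'
      field_simp
      linarith
    · have h1 : P v w = 0 := le_antisymm (not_lt.1 hp) (hP0 _ _)
      have h2 : P w v = 0 := le_antisymm (not_lt.1 fun h => hp ((hsym _ _).2 h)) (hP0 _ _)
      simp [h1, h2]
end

section
/- Let G = (V, ℰ) be a finite connected undirected graph without loops and let 𝒜 be the set of directed arcs obtained by orienting each edge both ways. In the polynomial ring ℚ[P_a : a ∈ 𝒜], the ideal generated by all binomials P^ω − P^{rω}, where ω ranges over closed trajectories of (V,𝒜), equals the ideal generated by the binomials P^c − P^{rc}, where c ranges over cycles (elementary closed trajectories); moreover the monomials P^c associated with cycles are square-free. -/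
open MvPolynomial

open Classical in
noncomputable def KY {V : Type*} (G : SimpleGraph V) (u v : V) :
    MvPolynomial {a : V × V // G.Adj a.1 a.2} ℚ :=
  if h : G.Adj u v then X ⟨(u, v), h⟩ else 0

lemma KY_pos {V : Type*} (G : SimpleGraph V) (u v : V) (h : G.Adj u v) :
    KY G u v = X ⟨(u, v), h⟩ := by
  simp [KY, h]

lemma K_main {V : Type*} (G : SimpleGraph V)
    (I : Ideal (MvPolynomial {a : V × V // G.Adj a.1 a.2} ℚ))
    (hI : ∀ (n : ℕ), 1 ≤ n → ∀ ω : ℕ → V, (∀ k < n, G.Adj (ω k) (ω (k+1))) → ω n = ω 0 →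
      (∀ i < n, ∀ j < n, ω i = ω j → i = j) →
      (∏ k ∈ Finset.range n, KY G (ω k) (ω (k+1))) -
        ∏ k ∈ Finset.range n, KY G (ω (k+1)) (ω k) ∈ I) :
    ∀ (n : ℕ) (ω : ℕ → V), (∀ k < n, G.Adj (ω k) (ω (k+1))) → ω n = ω 0 →
      (∏ k ∈ Finset.range n, KY G (ω k) (ω (k+1))) -
        ∏ k ∈ Finset.range n, KY G (ω (k+1)) (ω k) ∈ I := by
  intro n
  induction n using Nat.strong_induction_on with
  | _ n ih =>
  intro ω hω hc
  rcases Nat.eq_zero_or_pos n with h0 | hpos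
  · subst h0; simp
  by_cases hinj : ∀ i < n, ∀ j < n, ω i = ω j → i = j
  · exact hI n hpos ω hω hc hinj
  have : ∃ i d m, 0 < d ∧ 0 < m ∧ n = i + d + m ∧ ω i = ω (i + d) := by
    push Not at hinj
    obtain ⟨i, hi, j, hj, he, hne⟩ := hinj
    rcases lt_or_gt_of_ne hne with h | h
    · exact ⟨i, j - i, n - j, by omega, by omega, by omega, by
        rw [he]; congr 1; omega⟩
    · exact ⟨j, i - j, n - i, by omega, by omega, by omega, by
        rw [← he]; congr 1; omega⟩
  obtain ⟨i, d, m, hd, hm, rfl, he⟩ := this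
  have hin := ih d (by omega) (fun k => ω (i + k)) (fun k hk => hω (i + k) (by omega)) he.symm
  let τ : ℕ → V := fun k => if k < i then ω k else ω (k + d)
  have t1 : ∀ k, k ≤ i → τ k = ω k := by
    intro k hk
    by_cases h : k < i
    · simp [τ, h]
    · have : k = i := by omega
      subst this
      simp [τ, he]
  have t2 : ∀ k, τ (i + k) = ω (i + d + k) := by
    intro k
    simp only [τ]
    rw [if_neg (by omega)]
    congr 1; omega
  have hout := ih (i + m) (by omega) τ (by
    intro k hk
    by_cases h : k < i
    · rw [t1 k (by omega), t1 (k+1) (by omega)]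
      exact hω k (by omega)
    · obtain ⟨l, rfl⟩ := Nat.exists_eq_add_of_le (not_lt.mp h)
      rw [t2, add_assoc i l 1, t2]
      exact hω (i + d + l) (by omega)) (by
    rw [t2, t1 0 (by omega), hc])
  have e1 : ∀ F : V → V → MvPolynomial {a : V × V // G.Adj a.1 a.2} ℚ,
      ∏ k ∈ Finset.range (i + m), F (τ k) (τ (k+1)) =
      (∏ k ∈ Finset.range i, F (ω k) (ω (k+1))) *
        ∏ k ∈ Finset.range m, F (ω (i + d + k)) (ω (i + d + k + 1)) := by
    intro F
    rw [Finset.prod_range_add]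
    congr 1
    · refine Finset.prod_congr rfl fun k hk => ?_
      rw [Finset.mem_range] at hk
      rw [t1 k (by omega), t1 (k+1) (by omega)]
    · refine Finset.prod_congr rfl fun k hk => ?_
      rw [t2, add_assoc i k 1, t2, add_assoc (i + d)]
  have e2 := e1 (fun a b => KY G b a)
  rw [e1 (KY G), e2] at hout
  simp only [Finset.prod_range_add]
  simp only [← add_assoc] at hin
  have := I.add_mem
    (I.mul_mem_left (∏ k ∈ Finset.range d, KY G (ω (i + k)) (ω (i + k + 1))) hout)
    (I.mul_mem_left ((∏ k ∈ Finset.range i, KY G (ω (k+1)) (ω k)) *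
        ∏ k ∈ Finset.range m, KY G (ω (i + d + k + 1)) (ω (i + d + k))) hin)
  convert this using 1
  ring

lemma K_sqf {σ ι : Type*} (s : Finset ι) (f : ι → σ) (hf : Function.Injective f) :
    Squarefree (∏ k ∈ s, (X (f k) : MvPolynomial σ ℚ)) := by
  apply Finset.squarefree_prod_of_pairwise_isCoprime
  · intro i _ j _ hij
    refine (X_prime (R := ℚ) (i := f i)).irreducible.isRelPrime_iff_not_dvd.mpr ?_
    rw [X_dvd_X]
    exact fun h => hij (hf h)
  · intro i _
    exact (X_prime (R := ℚ) (i := f i)).irreducible.squarefree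

/-- In `ℚ[P_a : a ∈ 𝒜]`, the ideal generated by the binomials
`P^ω − P^{rω}` over all closed trajectories `ω` equals the ideal generated by the
binomials `P^c − P^{rc}` over all cycles `c`; moreover the monomials `P^c` associated
with cycles are square-free. -/
theorem stmt11 {V : Type*} [Fintype V] [DecidableEq V]
    (G : SimpleGraph V) (hG : G.Connected) :
    (Ideal.span {f : MvPolynomial {a : V × V // G.Adj a.1 a.2} ℚ |
        ∃ (n : ℕ) (_ : 1 ≤ n) (ω : Fin (n + 1) → V)
          (hω : ∀ k : Fin n, G.Adj (ω k.castSucc) (ω k.succ)),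
          ω (Fin.last n) = ω 0 ∧
          f = (∏ k : Fin n, X ⟨(ω k.castSucc, ω k.succ), hω k⟩)
            - ∏ k : Fin n, X ⟨(ω k.succ, ω k.castSucc), (hω k).symm⟩}
      = Ideal.span {f : MvPolynomial {a : V × V // G.Adj a.1 a.2} ℚ |
        ∃ (n : ℕ) (_ : 1 ≤ n) (ω : Fin (n + 1) → V)
          (hω : ∀ k : Fin n, G.Adj (ω k.castSucc) (ω k.succ)),
          ω (Fin.last n) = ω 0 ∧
          (∀ j j' : Fin n, ω j.castSucc = ω j'.castSucc → j = j') ∧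
          f = (∏ k : Fin n, X ⟨(ω k.castSucc, ω k.succ), hω k⟩)
            - ∏ k : Fin n, X ⟨(ω k.succ, ω k.castSucc), (hω k).symm⟩})
    ∧ ∀ (n : ℕ), 1 ≤ n → ∀ (ω : Fin (n + 1) → V)
        (hω : ∀ k : Fin n, G.Adj (ω k.castSucc) (ω k.succ)),
        ω (Fin.last n) = ω 0 →
        (∀ j j' : Fin n, ω j.castSucc = ω j'.castSucc → j = j') →
        Squarefree (∏ k : Fin n,
          (X ⟨(ω k.castSucc, ω k.succ), hω k⟩ :
            MvPolynomial {a : V × V // G.Adj a.1 a.2} ℚ)) := by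
  refine ⟨le_antisymm ?_ ?_, ?_⟩
  · rw [Ideal.span_le]
    rintro f ⟨n, hn, ω, hω, hc, rfl⟩
    have c1 : ∀ k : Fin n, Fin.ofNat (n+1) (k : ℕ) = k.castSucc := by
      intro k
      ext
      exact Nat.mod_eq_of_lt (by omega)
    have c2 : ∀ k : Fin n, Fin.ofNat (n+1) ((k : ℕ) + 1) = k.succ := by
      intro k
      ext
      exact Nat.mod_eq_of_lt (by omega)
    have e1 : (∏ k : Fin n, (X ⟨(ω k.castSucc, ω k.succ), hω k⟩ :
        MvPolynomial {a : V × V // G.Adj a.1 a.2} ℚ)) =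
        ∏ k ∈ Finset.range n, KY G (ω (Fin.ofNat (n+1) k)) (ω (Fin.ofNat (n+1) (k+1))) := by
      rw [Finset.prod_range]
      refine Finset.prod_congr rfl fun k _ => ?_
      rw [← KY_pos G, c1, c2]
    have e2 : (∏ k : Fin n, (X ⟨(ω k.succ, ω k.castSucc), (hω k).symm⟩ :
        MvPolynomial {a : V × V // G.Adj a.1 a.2} ℚ)) =
        ∏ k ∈ Finset.range n, KY G (ω (Fin.ofNat (n+1) (k+1))) (ω (Fin.ofNat (n+1) k)) := by
      rw [Finset.prod_range]
      refine Finset.prod_congr rfl fun k _ => ?_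
      rw [← KY_pos G, c1, c2]
    rw [SetLike.mem_coe, e1, e2]
    refine K_main G _ ?_ n (fun k => ω (Fin.ofNat (n+1) k)) ?_ ?_
    · intro n hn ω hω hc hinj
      refine Ideal.subset_span ⟨n, hn, fun k => ω k,
        fun k => hω k k.2, hc, fun j j' h => Fin.ext (hinj j j.2 j' j'.2 h), ?_⟩
      rw [Finset.prod_range, Finset.prod_range]
      congr 1
      · exact Finset.prod_congr rfl fun k _ => KY_pos G _ _ (hω k k.2)
      · exact Finset.prod_congr rfl fun k _ => KY_pos G _ _ (hω k k.2).symm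
    · intro k hk
      have := hω ⟨k, hk⟩
      rw [← c1, ← c2] at this
      exact this
    · convert hc using 2
      · ext; simp
      · rfl
  · apply Ideal.span_mono
    rintro f ⟨n, hn, ω, hω, hc, -, hf⟩
    exact ⟨n, hn, ω, hω, hc, hf⟩
  · intro n hn ω hω hc hinj
    apply K_sqf Finset.univ (fun k : Fin n =>
      (⟨(ω k.castSucc, ω k.succ), hω k⟩ : {a : V × V // G.Adj a.1 a.2}))
    intro j j' h
    simp only [Subtype.mk.injEq, Prod.mk.injEq] at h
    exact hinj j j' h.1
end

section
/- Let G = (V, ℰ) be a finite connected undirected graph without loops, 𝒜 its set of arcs, 𝒮 the set of nonempty proper subsets of V, and suppose (P_a)_{a∈𝒜} is given in the monomial form P_{v→w} = s({v,w}) · ∏_{B∈𝒮 : v∈B, w∉B} t_B · ∏_{B∈𝒮 : w∈B, v∉B} t_B^{−1} with s(e) > 0 and t_B > 0. Then a strictly positive function κ: V → ℝ_{>0} satisfies the detailed balance equations κ(v) P_{v→w} = κ(w) P_{w→v} for all arcs if, and only if, κ is proportional to v ↦ ∏_{B∈𝒮 : v∈B} t_B^{−2}. -/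
/-- For a family `(P_a)` in monomial form on the arcs of a finite connected
graph, a strictly positive `κ` satisfies the detailed balance equations iff `κ` is
proportional to `v ↦ ∏_{B ∋ v} t_B^{-2}`. -/
theorem stmt15 {V : Type*} [Fintype V] [DecidableEq V]
    (G : SimpleGraph V) (hG : G.Connected)
    (s : V → V → ℝ) (hssym : ∀ v w, s v w = s w v) (hspos : ∀ v w, G.Adj v w → 0 < s v w)
    (t : Finset V → ℝ) (ht : ∀ B, 0 < t B)
    (P : V → V → ℝ)
    (hP : ∀ v w, G.Adj v w → P v w = s v w *
        (∏ B ∈ Finset.univ.filter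
          (fun B : Finset V => B.Nonempty ∧ B ≠ Finset.univ ∧ v ∈ B ∧ w ∉ B), t B) *
        (∏ B ∈ Finset.univ.filter
          (fun B : Finset V => B.Nonempty ∧ B ≠ Finset.univ ∧ w ∈ B ∧ v ∉ B), t B)⁻¹)
    (κ : V → ℝ) (hκ : ∀ v, 0 < κ v) :
    (∀ v w, G.Adj v w → κ v * P v w = κ w * P w v)
      ↔ ∃ c : ℝ, 0 < c ∧ ∀ v, κ v = c *
          (∏ B ∈ Finset.univ.filter
            (fun B : Finset V => B.Nonempty ∧ B ≠ Finset.univ ∧ v ∈ B), t B ^ 2)⁻¹ := by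
  classical
  set A : V → V → ℝ := fun v w => ∏ B ∈ Finset.univ.filter
          (fun B : Finset V => B.Nonempty ∧ B ≠ Finset.univ ∧ v ∈ B ∧ w ∉ B), t B with hA
  set C : V → V → ℝ := fun v w => ∏ B ∈ Finset.univ.filter
          (fun B : Finset V => B.Nonempty ∧ B ≠ Finset.univ ∧ v ∈ B ∧ w ∈ B), t B with hC
  set F : V → ℝ := fun v => ∏ B ∈ Finset.univ.filter
            (fun B : Finset V => B.Nonempty ∧ B ≠ Finset.univ ∧ v ∈ B), t B ^ 2 with hF
  have hApos : ∀ v w, 0 < A v w := fun v w => Finset.prod_pos fun B _ => ht B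
  have hCpos : ∀ v w, 0 < C v w := fun v w => Finset.prod_pos fun B _ => ht B
  have hFpos : ∀ v, 0 < F v := fun v => Finset.prod_pos fun B _ => pow_pos (ht B) 2
  have hCsymm : ∀ v w, C v w = C w v := by
    intro v w
    simp only [hC]
    congr 1
    ext B
    simp only [Finset.mem_filter]
    tauto
  have hFA : ∀ v w, F v = (C v w * A v w) ^ 2 := by
    intro v w
    simp only [hF, hC, hA]
    rw [Finset.prod_pow, ← Finset.prod_filter_mul_prod_filter_not _ (fun B : Finset V => w ∈ B),
      Finset.filter_filter, Finset.filter_filter]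
    simp only [and_assoc]
  have key : ∀ v w, G.Adj v w →
      (κ v * P v w = κ w * P w v ↔ κ v * F v = κ w * F w) := by
    intro v w h
    have h1 : P v w = s v w * A v w * (A w v)⁻¹ := hP v w h
    have h2 : P w v = s v w * A w v * (A v w)⁻¹ := by rw [hssym v w]; exact hP w v h.symm
    have hs := (hspos v w h).ne'
    have a1 := (hApos v w).ne'
    have a2 := (hApos w v).ne'
    have c := (hCpos v w).ne'
    rw [h1, h2, hFA v w, hFA w v, hCsymm w v]
    have e1 : κ v * (s v w * A v w * (A w v)⁻¹) =
        (s v w * (A v w)⁻¹ * (A w v)⁻¹) * (κ v * A v w ^ 2) := by field_simp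
    have e2 : κ w * (s v w * A w v * (A v w)⁻¹) =
        (s v w * (A v w)⁻¹ * (A w v)⁻¹) * (κ w * A w v ^ 2) := by field_simp
    have e3 : κ v * (C v w * A v w) ^ 2 = C v w ^ 2 * (κ v * A v w ^ 2) := by ring
    have e4 : κ w * (C v w * A w v) ^ 2 = C v w ^ 2 * (κ w * A w v ^ 2) := by ring
    rw [e1, e2, e3, e4, mul_right_inj' (by positivity), mul_right_inj' (by positivity)]
  constructor
  · intro h
    obtain ⟨v0⟩ := hG.nonempty
    refine ⟨κ v0 * F v0, mul_pos (hκ _) (hFpos _), fun v => ?_⟩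
    have hc : κ v0 * F v0 = κ v * F v := by
      obtain ⟨p⟩ := hG.preconnected v0 v
      induction p with
      | nil => rfl
      | cons hadj _ ih => exact ((key _ _ hadj).1 (h _ _ hadj)).trans ih
    change κ v = _ * (F v)⁻¹
    rw [hc, mul_inv_cancel_right₀ (hFpos v).ne']
  · rintro ⟨c, -, h⟩ v w hadj
    rw [key v w hadj]
    have hh : ∀ v, κ v * F v = c := fun v => by
      have : κ v = c * (F v)⁻¹ := h v
      rw [this, inv_mul_cancel_right₀ (hFpos v).ne']
    rw [hh, hh]
end

section
/- Let G = (V, ℰ) be a finite connected undirected graph without loops and 𝒜 its set of arcs. In the polynomial ring ℚ[κ(v), v∈V; P_a, a∈𝒜], let the detailed balance ideal be the ideal generated by ∏_{v∈V} κ(v) − 1 together with the binomials κ(v) P_{v→w} − κ(w) P_{w→v} for all arcs (v→w) ∈ 𝒜. Then the Kolmogorov ideal of G (the ideal of ℚ[P_a : a∈𝒜] generated by the binomials P^ω − P^{rω} over closed trajectories ω) equals the elimination ideal of the detailed balance ideal with respect to the κ-variables, i.e. its intersection with the subring ℚ[P_a : a∈𝒜]. -/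
open MvPolynomial

namespace KIdeal

variable {V : Type*} [Fintype V] [DecidableEq V] (G : SimpleGraph V)

abbrev Arc := {a : V × V // G.Adj a.1 a.2}

variable (V) in
abbrev NN := (Sym2 V → ℤ) × (V → ℚ)

variable {G}

def rev (a : Arc G) : Arc G := ⟨(a.1.2, a.1.1), a.2.symm⟩

lemma rev_rev (a : Arc G) : rev (rev a) = a := rfl

lemma rev_ne (a : Arc G) : rev a ≠ a := by
  intro h
  have := congrArg (fun x => x.1.1) h
  exact a.2.ne this.symm

variable (G) in
def gens : Set (MvPolynomial (Arc G) ℚ) := {f : MvPolynomial {a : V × V // G.Adj a.1 a.2} ℚ |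
        ∃ (n : ℕ) (_ : 1 ≤ n) (ω : Fin (n + 1) → V)
          (hω : ∀ k : Fin n, G.Adj (ω k.castSucc) (ω k.succ)),
          ω (Fin.last n) = ω 0 ∧
          f = (∏ k : Fin n, X ⟨(ω k.castSucc, ω k.succ), hω k⟩)
            - ∏ k : Fin n, X ⟨(ω k.succ, ω k.castSucc), (hω k).symm⟩}

noncomputable def E : (Arc G →₀ ℕ) →ₗ[ℕ] (Sym2 V → ℤ) :=
  Finsupp.linearCombination ℕ (fun a => Pi.single s(a.1.1, a.1.2) 1)

noncomputable def H : (Arc G →₀ ℕ) →ₗ[ℕ] (V → ℚ) :=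
  Finsupp.linearCombination ℕ (fun a => Pi.single a.1.2 1)

noncomputable def R : (Arc G →₀ ℕ) →ₗ[ℕ] (Arc G →₀ ℕ) := Finsupp.lmapDomain ℕ ℕ rev

lemma R_single (a : Arc G) (n : ℕ) : R (Finsupp.single a n) = Finsupp.single (rev a) n := by
  simp [R]

lemma R_apply (α : Arc G →₀ ℕ) (a : Arc G) : R α a = α (rev a) := by
  have : Function.Injective (rev : Arc G → Arc G) := fun x y h => by
    have := congrArg rev h
    simpa [rev_rev] using this
  have h := Finsupp.mapDomain_apply this α (rev a)
  rw [rev_rev] at h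
  exact h

lemma E_apply (α : Arc G →₀ ℕ) (a : Arc G) :
    E α s(a.1.1, a.1.2) = α a + α (rev a) := by
  induction α using Finsupp.induction_linear with
  | zero => simp
  | add f g hf hg => simp only [map_add, Pi.add_apply, hf, hg, Finsupp.add_apply]; push_cast; ring
  | single b n =>
    have hne := rev_ne a
    simp only [E, Finsupp.linearCombination_single, Pi.smul_apply, Pi.single_apply,
      Finsupp.single_apply]
    by_cases h1 : b = a
    · subst h1
      simp [hne.symm]
    · by_cases h2 : b = rev a
      · subst h2
        have e : s((rev a).1.1, (rev a).1.2) = s(a.1.1, a.1.2) := Sym2.eq_swap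
        simp [hne, e]
      · have : s(a.1.1, a.1.2) ≠ s(b.1.1, b.1.2) := by
          intro h
          rw [Sym2.eq_iff] at h
          rcases h with h | h
          · exact h1 (Subtype.ext (Prod.ext h.1.symm h.2.symm))
          · exact h2 (Subtype.ext (Prod.ext h.2.symm h.1.symm))
        simp [h1, h2, this]

noncomputable def fe : ∀ {u v : V}, G.Walk u v → (Arc G →₀ ℕ)
  | _, _, .nil => 0
  | u, _, .cons (v := v) h p => Finsupp.single ⟨(u, v), h⟩ 1 + fe p

lemma H_fe {u v : V} (p : G.Walk u v) :
    H (fe p) - H (R (fe p)) = Pi.single v 1 - Pi.single u 1 := by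
  induction p with
  | nil => simp [fe]
  | cons h p ih =>
    simp only [fe, map_add, R_single]
    simp only [H, Finsupp.linearCombination_single, one_smul, rev] at ih ⊢
    rw [add_sub_add_comm, ih]; abel

noncomputable abbrev m (α : Arc G →₀ ℕ) : MvPolynomial (Arc G) ℚ := monomial α 1

lemma m_add (α β : Arc G →₀ ℕ) : m (α + β) = m α * m β := by simp [m, monomial_mul]

lemma fe_prod {u v : V} (p : G.Walk u v) :
    m (fe p) = ∏ k : Fin p.length, X (⟨(p.getVert k, p.getVert (k + 1)),
      p.adj_getVert_succ k.2⟩ : Arc G) := by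
  induction p with
  | nil => simp only [fe, map_zero]; rfl
  | cons h p ih =>
    simp only [fe, m_add, ih]
    erw [Fin.prod_univ_succ]
    congr 1
    simp [m, X]

lemma fe_prod' {u v : V} (p : G.Walk u v) :
    m (R (fe p)) = ∏ k : Fin p.length, X (⟨(p.getVert (k+1), p.getVert k),
      (p.adj_getVert_succ k.2).symm⟩ : Arc G) := by
  induction p with
  | nil => simp only [fe, map_zero]; rfl
  | cons h p ih =>
    simp only [fe, map_add, m_add, ih, R_single]
    erw [Fin.prod_univ_succ]
    congr 1
    simp [m, X, rev]

lemma fe_mem {u : V} (p : G.Walk u u) :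
    m (fe p) - m (R (fe p)) ∈ Ideal.span (gens G) := by
  rcases Nat.eq_zero_or_pos p.length with h | h
  · have : p = .nil := by
      cases p with
      | nil => rfl
      | cons => simp at h
    subst this
    simp [fe]
  · apply Ideal.subset_span
    refine ⟨p.length, h, fun k => p.getVert k, fun k => p.adj_getVert_succ k.2, by simp, ?_⟩
    rw [fe_prod, fe_prod']
    rfl

lemma bal_mem : ∀ (n : ℕ) {u v : V} (p : G.Walk u v) (α : Arc G →₀ ℕ), α.degree = n →
    Pi.single v 1 - Pi.single u 1 + (H α - H (R α)) = 0 →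
    m (fe p + α) - m (R (fe p + α)) ∈ Ideal.span (gens G) := by
  intro n
  induction n with
  | zero =>
    intro u v p α hα hb
    have : α = 0 := by rwa [Finsupp.degree_eq_zero_iff] at hα
    subst this
    by_cases huv : u = v
    · subst huv
      simpa using fe_mem p
    · have := congrFun hb v
      simp [Pi.single_apply, Ne.symm huv] at this
  | succ n ih =>
    -- extension step
    have ext : ∀ {u v : V} (p : G.Walk u v) (α : Arc G →₀ ℕ), α.degree = n + 1 →
        Pi.single v 1 - Pi.single u 1 + (H α - H (R α)) = 0 →
        ∀ a : Arc G, a.1.2 = u → α a ≠ 0 →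
        m (fe p + α) - m (R (fe p + α)) ∈ Ideal.span (gens G) := by
      intro u v p α hα hb a ha haα
      obtain ⟨⟨w, u'⟩, hadj⟩ := a
      dsimp at ha
      subst ha
      obtain ⟨β, rfl⟩ : ∃ β, α = Finsupp.single ⟨(w, u'), hadj⟩ 1 + β :=
        ⟨α - Finsupp.single ⟨(w, u'), hadj⟩ 1, by
          rw [add_tsub_cancel_of_le]
          rw [Finsupp.single_le_iff]; omega⟩
      have h := ih (.cons hadj p) β (by simp at hα; omega) (by
        rw [← hb]
        simp only [map_add, R_single]
        simp only [H, Finsupp.linearCombination_single, one_smul, rev]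
        abel)
      have e : fe (.cons hadj p) + β = fe p + (Finsupp.single ⟨(w, u'), hadj⟩ 1 + β) := by
        simp only [fe]; abel
      rwa [e] at h
    intro u v p α hα hb
    by_cases huv : u = v
    · subst huv
      obtain ⟨a, ha⟩ : ∃ a, α a ≠ 0 := by
        by_contra! h
        have : α = 0 := Finsupp.ext h
        simp [this] at hα
      have h1 := ext (.nil : G.Walk a.1.2 a.1.2) α hα (by simpa using hb) a rfl ha
      simp only [fe, zero_add] at h1
      rw [map_add, m_add, m_add]
      have : m (fe p) * m α - m (R (fe p)) * m (R α) =
        m α * (m (fe p) - m (R (fe p))) + m (R (fe p)) * (m α - m (R α)) := by ring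
      rw [this]
      exact Ideal.add_mem _ (Ideal.mul_mem_left _ _ (fe_mem p)) (Ideal.mul_mem_left _ _ h1)
    · by_cases hex : ∃ a : Arc G, a.1.2 = u ∧ α a ≠ 0
      · obtain ⟨a, h1, h2⟩ := hex
        exact ext p α hα hb a h1 h2
      · exfalso
        push Not at hex
        have h0 : H α u = 0 := by
          simp only [H, Finsupp.linearCombination_apply, Finsupp.sum, Finset.sum_apply]
          refine Finset.sum_eq_zero fun a ha => ?_
          have : a.1.2 ≠ u := fun h => (Finsupp.mem_support_iff.1 ha) (hex a h)
          simp [Pi.single_apply, this.symm]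
        have h1 : 0 ≤ H (R α) u := by
          simp only [H, Finsupp.linearCombination_apply, Finsupp.sum, Finset.sum_apply]
          refine Finset.sum_nonneg fun a ha => ?_
          simp only [Pi.smul_apply, Pi.single_apply]
          split_ifs <;> simp
        have := congrFun hb u
        simp [Pi.single_apply, huv, h0] at this
        linarith

lemma key (α β : Arc G →₀ ℕ) (hE : E α = E β) (hH : H α = H β) :
    m α - m β ∈ Ideal.span (gens G) := by
  obtain ⟨α', hα⟩ : ∃ α', α = α ⊓ β + α' := ⟨α - α ⊓ β, by
    rw [add_tsub_cancel_of_le inf_le_left]⟩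
  obtain ⟨β', hβ⟩ : ∃ β', β = α ⊓ β + β' := ⟨β - α ⊓ β, by
    rw [add_tsub_cancel_of_le inf_le_right]⟩
  have hd : ∀ a, α' a = 0 ∨ β' a = 0 := by
    intro a
    have h1 := DFunLike.congr_fun hα a
    have h2 := DFunLike.congr_fun hβ a
    simp only [Finsupp.add_apply, Finsupp.inf_apply] at h1 h2
    rcases le_total (α a) (β a) with h | h
    · rw [inf_eq_left.2 h] at h1; omega
    · rw [inf_eq_right.2 h] at h2; omega
  generalize α ⊓ β = γ at hα hβ
  subst hα hβ
  simp only [map_add, add_right_inj] at hE hH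
  have hR : β' = R α' := by
    ext a
    rw [R_apply]
    have h := congrFun hE s(a.1.1, a.1.2)
    rw [E_apply, E_apply] at h
    have := hd a
    have := hd (rev a)
    omega
  subst hR
  rw [m_add, m_add, ← mul_sub]
  apply Ideal.mul_mem_left
  by_cases h0 : α' = 0
  · simp [h0]
  · obtain ⟨a, ha⟩ := Finsupp.ne_iff.1 h0
    have := bal_mem _ (.nil : G.Walk a.1.1 a.1.1) α' rfl (by simp [hH])
    simpa [fe] using this

lemma easy {Q : Type*} [CommRing Q] (κ : V → Q) (P : Arc G → Q)
    (hP : ∀ a, κ a.1.1 * P a = κ a.1.2 * P (rev a)) :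
    ∀ (n : ℕ) (ω : Fin (n + 1) → V) (hω : ∀ k : Fin n, G.Adj (ω k.castSucc) (ω k.succ)),
    κ (ω 0) * ∏ k : Fin n, P ⟨(ω k.castSucc, ω k.succ), hω k⟩ =
    κ (ω (Fin.last n)) * ∏ k : Fin n, P ⟨(ω k.succ, ω k.castSucc), (hω k).symm⟩ := by
  intro n
  induction n with
  | zero => intro ω hω; simp
  | succ n ih =>
    intro ω hω
    rw [Fin.prod_univ_succ, Fin.prod_univ_succ]
    have h1 := ih (fun k => ω k.succ) (fun k => hω k.succ)
    have h2 := hP ⟨(ω (Fin.castSucc 0), ω (Fin.succ 0)), hω 0⟩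
    simp only [rev] at h2
    rw [← mul_assoc]
    erw [h2]
    erw [mul_right_comm, h1]
    rw [Fin.succ_last]
    simp only [Fin.succ_castSucc]
    ring

end KIdeal



/-- The Kolmogorov ideal of a finite connected graph (generated in
`ℚ[P_a : a ∈ 𝒜]` by the binomials `P^ω − P^{rω}` over closed trajectories `ω`) equals the
elimination ideal, with respect to the `κ`-variables, of the detailed balance ideal
generated by `∏_v κ(v) − 1` and the binomials `κ(v) P_{v→w} − κ(w) P_{w→v}`. -/
theorem stmt16 {V : Type*} [Fintype V] [DecidableEq V]
    (G : SimpleGraph V) (hG : G.Connected) :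
    Ideal.span {f : MvPolynomial {a : V × V // G.Adj a.1 a.2} ℚ |
        ∃ (n : ℕ) (_ : 1 ≤ n) (ω : Fin (n + 1) → V)
          (hω : ∀ k : Fin n, G.Adj (ω k.castSucc) (ω k.succ)),
          ω (Fin.last n) = ω 0 ∧
          f = (∏ k : Fin n, X ⟨(ω k.castSucc, ω k.succ), hω k⟩)
            - ∏ k : Fin n, X ⟨(ω k.succ, ω k.castSucc), (hω k).symm⟩}
      = Ideal.comap
          (MvPolynomial.rename
            (Sum.inr : {a : V × V // G.Adj a.1 a.2} →
              V ⊕ {a : V × V // G.Adj a.1 a.2})).toRingHom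
          (Ideal.span
            ({(∏ v : V, X (Sum.inl v)) - 1} ∪
              {f : MvPolynomial (V ⊕ {a : V × V // G.Adj a.1 a.2}) ℚ |
                ∃ a : {a : V × V // G.Adj a.1 a.2},
                  f = X (Sum.inl a.val.1) * X (Sum.inr a)
                    - X (Sum.inl a.val.2) *
                      X (Sum.inr ⟨(a.val.2, a.val.1), a.prop.symm⟩)})) := by
  classical
  change Ideal.span (KIdeal.gens G) = _
  apply le_antisymm
  · rw [Ideal.span_le]
    rintro f ⟨n, hn, ω, hω, hcl, rfl⟩
    set D := Ideal.span
            ({(∏ v : V, X (Sum.inl v)) - 1} ∪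
              {f : MvPolynomial (V ⊕ {a : V × V // G.Adj a.1 a.2}) ℚ |
                ∃ a : {a : V × V // G.Adj a.1 a.2},
                  f = X (Sum.inl a.val.1) * X (Sum.inr a)
                    - X (Sum.inl a.val.2) *
                      X (Sum.inr ⟨(a.val.2, a.val.1), a.prop.symm⟩)}) with hD
    have h := KIdeal.easy (G := G) (fun v => Ideal.Quotient.mk D (X (Sum.inl v)))
      (fun a => Ideal.Quotient.mk D (X (Sum.inr a))) (by
        intro a
        rw [← map_mul, ← map_mul, Ideal.Quotient.eq]
        exact Ideal.subset_span (Or.inr ⟨a, rfl⟩)) n ω hω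
    rw [hcl] at h
    have hu : IsUnit (Ideal.Quotient.mk D (X (Sum.inl (ω 0)))) := by
      have h1 : Ideal.Quotient.mk D (∏ v : V, X (Sum.inl v)) = 1 := by
        rw [← map_one (Ideal.Quotient.mk D), Ideal.Quotient.eq]
        exact Ideal.subset_span (Or.inl rfl)
      refine isUnit_of_dvd_one (h1 ▸ ?_)
      exact map_dvd _ (Finset.dvd_prod_of_mem _ (Finset.mem_univ _))
    have h3 := hu.mul_left_cancel h
    rw [← map_prod, ← map_prod, Ideal.Quotient.eq] at h3
    simpa [Ideal.mem_comap] using h3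
  · intro f hf
    rw [Ideal.mem_comap] at hf
    have : Nonempty V := hG.nonempty
    have hcard : (Fintype.card V : ℚ) ≠ 0 := by simp
    let g : V ⊕ {a : V × V // G.Adj a.1 a.2} → (KIdeal.NN V) := Sum.elim
      (fun v => (0, Pi.single v 1 - fun _ => (Fintype.card V : ℚ)⁻¹))
      (fun a => (Pi.single s(a.1.1, a.1.2) 1, Pi.single a.1.2 1))
    let φ : MvPolynomial (V ⊕ {a : V × V // G.Adj a.1 a.2}) ℚ →ₐ[ℚ] AddMonoidAlgebra ℚ (KIdeal.NN V) :=
      aeval (fun i => AddMonoidAlgebra.single (g i) 1)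
    have hφX : ∀ i, φ (X i) = AddMonoidAlgebra.single (g i) 1 := fun i => aeval_X _ i
    have hprod : ∀ (s : Finset V) (t : V → (KIdeal.NN V)),
        ∏ v ∈ s, (AddMonoidAlgebra.single (t v) 1 : AddMonoidAlgebra ℚ (KIdeal.NN V))
          = AddMonoidAlgebra.single (∑ v ∈ s, t v) 1 := by
      intro s t
      induction s using Finset.induction_on with
      | empty => simp [AddMonoidAlgebra.one_def]
      | insert a s ha ih =>
        rw [Finset.prod_insert ha, Finset.sum_insert ha, ih, AddMonoidAlgebra.single_mul_single,
          one_mul]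
    have hker : ∀ x ∈ Ideal.span
            ({(∏ v : V, X (Sum.inl v)) - 1} ∪
              {f : MvPolynomial (V ⊕ {a : V × V // G.Adj a.1 a.2}) ℚ |
                ∃ a : {a : V × V // G.Adj a.1 a.2},
                  f = X (Sum.inl a.val.1) * X (Sum.inr a)
                    - X (Sum.inl a.val.2) *
                      X (Sum.inr ⟨(a.val.2, a.val.1), a.prop.symm⟩)}), φ x = 0 := by
      intro x hx
      rw [← RingHom.mem_ker]
      revert x
      change Ideal.span _ ≤ RingHom.ker φ
      rw [Ideal.span_le]
      rintro x (rfl | ⟨a, rfl⟩)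
      · rw [SetLike.mem_coe, RingHom.mem_ker, map_sub, map_prod, map_one, sub_eq_zero]
        simp only [hφX]
        rw [hprod, AddMonoidAlgebra.one_def]
        congr 1
        refine Prod.ext ?_ ?_
        · simp [g, Prod.fst_sum]
        · funext w
          simp [g, Prod.snd_sum, Finset.sum_apply, Pi.single_apply, hcard]
      · rw [SetLike.mem_coe, RingHom.mem_ker, map_sub, map_mul, map_mul, sub_eq_zero]
        simp only [hφX, AddMonoidAlgebra.single_mul_single, one_mul]
        congr 1
        refine Prod.ext ?_ ?_
        · simp [g, Sym2.eq_swap]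
        · simp only [g, Sum.elim_inl, Sum.elim_inr, Prod.snd_add]
          abel
    have hφ := hker _ hf
    let W : (KIdeal.Arc G →₀ ℕ) → (KIdeal.NN V) := fun α => (KIdeal.E α, KIdeal.H α)
    have hmon : ∀ α : KIdeal.Arc G →₀ ℕ, φ (rename Sum.inr (KIdeal.m α)) =
        AddMonoidAlgebra.single (W α) 1 := by
      intro α
      induction α using Finsupp.induction_linear with
      | zero =>
        have : KIdeal.m (0 : KIdeal.Arc G →₀ ℕ) = 1 := by simp [KIdeal.m]
        rw [this, map_one, map_one, AddMonoidAlgebra.one_def]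
        simp [W]
        rfl
      | add a b ha hb =>
        rw [KIdeal.m_add, map_mul, map_mul, ha, hb, AddMonoidAlgebra.single_mul_single, one_mul]
        simp [W]
      | single a n =>
        have : KIdeal.m (Finsupp.single a n) = X a ^ n := by
          simp [KIdeal.m, X_pow_eq_monomial]
        rw [this, map_pow, map_pow, rename_X, hφX, AddMonoidAlgebra.single_pow, one_pow]
        congr 1
        simp [W, KIdeal.E, KIdeal.H, g]
    let K := Ideal.span (KIdeal.gens G)
    let s : (KIdeal.NN V) → MvPolynomial (KIdeal.Arc G) ℚ ⧸ K := fun n =>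
      if h : ∃ α, W α = n then Ideal.Quotient.mk K (KIdeal.m h.choose) else 0
    have hs : ∀ α, s (W α) = Ideal.Quotient.mk K (KIdeal.m α) := by
      intro α
      have h : ∃ β, W β = W α := ⟨α, rfl⟩
      simp only [s, dif_pos h]
      rw [Ideal.Quotient.eq]
      have := h.choose_spec
      exact KIdeal.key _ _ (congrArg Prod.fst this) (congrArg Prod.snd this)
    let S : AddMonoidAlgebra ℚ (KIdeal.NN V) →ₗ[ℚ] MvPolynomial (KIdeal.Arc G) ℚ ⧸ K :=
      (Finsupp.linearCombination ℚ s) ∘ₗ (AddMonoidAlgebra.coeffLinearEquiv ℚ).toLinearMap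
    have hS : S ∘ₗ φ.toLinearMap ∘ₗ (rename Sum.inr).toLinearMap
        = (Ideal.Quotient.mkₐ ℚ K).toLinearMap := by
      apply MvPolynomial.linearMap_ext
      intro α
      apply LinearMap.ext_ring
      change S (φ (rename Sum.inr (KIdeal.m α))) = Ideal.Quotient.mk K (KIdeal.m α)
      rw [hmon, ← hs]
      simp [S]
    have h1 := LinearMap.congr_fun hS f
    have h2 : S (φ (rename Sum.inr f)) = Ideal.Quotient.mk K f := h1
    have h3 : φ (rename Sum.inr f) = 0 := hφ
    rw [h3, map_zero] at h2
    exact Ideal.Quotient.eq_zero_iff_mem.1 h2.symm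
end
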